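/- arXiv:1308.6562 — 9 statements merged into one kernel-verified Lean document; each statement's English description precedes it below -/
import Mathlib

section
/- Let F ∈ ℝ^{n×⋯×n} be a symmetric tensor of order m. Then F has a best rank-1 approximation that is a symmetric rank-1 tensor: there exist λ ∈ ℝ and a unit vector u ∈ ℝ^n such that ‖F − λ·u^{⊗m}‖ ≤ ‖F − μ·v¹⊗⋯⊗v^m‖ for all μ ∈ ℝ and all unit vectors v¹,…,v^m ∈ ℝ^n, where u^{⊗m} = u⊗⋯⊗u (m times). -/
open Finset

theorem aux_sum_update {E : Type*} [AddCommGroup E] {m : ℕ} (v : Fin m → E) (i : Fin m) (a : E) :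
    ∑ k, Function.update v i a k = ∑ k, v k - v i + a := by
  have h1 := Finset.sum_update_of_mem (Finset.mem_univ i) v a
  have h2 := Finset.sum_sdiff (f := v) (Finset.subset_univ {i})
  rw [h1, ← h2]
  simp only [Finset.sum_singleton]
  abel

theorem aux_banach {E : Type*} [NormedAddCommGroup E] [InnerProductSpace ℝ E]
    [FiniteDimensional ℝ E] [Nontrivial E] {m : ℕ} (hm : 0 < m)
    (T : MultilinearMap ℝ (fun _ : Fin m => E) ℝ) (hT : Continuous T)
    (hs : ∀ (v : Fin m → E) (σ : Equiv.Perm (Fin m)), T (v ∘ σ) = T v) :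
    ∃ u : E, ‖u‖ = 1 ∧ ∀ v : Fin m → E, (∀ j, ‖v j‖ = 1) → |T v| ≤ |T (fun _ => u)| := by
  obtain ⟨e, he⟩ := exists_norm_eq E (c := (1 : ℝ)) zero_le_one
  have hK : IsCompact {v : Fin m → E | ∀ j, ‖v j‖ = 1} := by
    have := isCompact_univ_pi (fun _ : Fin m => isCompact_sphere (0 : E) 1)
    convert this using 1
    ext v
    simp
  obtain ⟨v0, hv0, hmax0⟩ := hK.exists_isMaxOn ⟨fun _ => e, fun _ => he⟩
    (hT.abs.continuousOn)
  have hmax : ∀ v : Fin m → E, (∀ j, ‖v j‖ = 1) → |T v| ≤ |T v0| := fun v hv => hmax0 hv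
  set M := |T v0| with hM
  have hK2 : IsCompact ({v : Fin m → E | ∀ j, ‖v j‖ = 1} ∩ {v | |T v| = M}) :=
    hK.inter_right (isClosed_eq hT.abs continuous_const)
  obtain ⟨v, ⟨hv, hvM⟩, hpot0⟩ := hK2.exists_isMaxOn ⟨v0, hv0, rfl⟩
    (f := fun v => ‖∑ k, v k‖ ^ 2) (by fun_prop)
  have hpot : ∀ w : Fin m → E, (∀ j, ‖w j‖ = 1) → |T w| = M →
    ‖∑ k, w k‖ ^ 2 ≤ ‖∑ k, v k‖ ^ 2 := fun w h1 h2 => hpot0 ⟨h1, h2⟩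
  change ∀ j, ‖v j‖ = 1 at hv
  change |T v| = M at hvM
  clear hpot0 hmax0 hK2
  set S := ∑ k, v k with hS
  have hSv : ∀ j, 1 ≤ inner ℝ S (v j) := by
    intro j
    have h := hpot (Function.update v j (-v j)) (by
      intro k
      by_cases hk : k = j
      · subst hk; simp [hv]
      · simp [hk, hv]) (by
      rw [T.map_update_neg]; simpa using hvM)
    rw [aux_sum_update, ← hS] at h
    have e1 : S - v j + -v j = S - (2 : ℝ) • v j := by rw [two_smul]; abel
    rw [e1, norm_sub_sq_real, norm_smul, inner_smul_right, hv j] at h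
    norm_num at h
    linarith
  have key : ∀ i j, v i = v j := by
    intro i j
    by_contra hne
    have hij : i ≠ j := fun h => hne (by rw [h])
    let B : E → E → ℝ := fun a b => T (Function.update (Function.update v i a) j b)
    have Badd2 : ∀ a b c, B a (b + c) = B a b + B a c := fun a b c => T.map_update_add _ _ _ _
    have Bsm2 : ∀ (r : ℝ) a b, B a (r • b) = r * B a b := fun r a b => T.map_update_smul _ _ _ _
    have Bsymm : ∀ a b, B a b = B b a := by
      intro a b
      have h := hs (Function.update (Function.update v i a) j b) (Equiv.swap i j)
      have hv' : ∀ k, k ≠ i → k ≠ j → True := fun _ _ _ => trivial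
      have h1 : (fun k => Function.update (Function.update v i a) j b (Equiv.swap i j k))
          = Function.update (Function.update (v ∘ Equiv.swap i j) i b) j a := by
        funext k
        by_cases hki : k = i
        · subst hki; simp [hij]
        · by_cases hkj : k = j
          · subst hkj; simp [hij]
          · simp [hki, hkj, Equiv.swap_apply_of_ne_of_ne hki hkj]
      have h2 : Function.update (Function.update (v ∘ Equiv.swap i j) i b) j a
          = Function.update (Function.update v i b) j a := by
        funext k
        by_cases hkj : k = j
        · subst hkj; simp
        · by_cases hki : k = i
          · subst hki; simp [hij]
          · simp [hki, hkj, Equiv.swap_apply_of_ne_of_ne hki hkj]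
      have h3 : (Function.update (Function.update v i a) j b) ∘ (Equiv.swap i j)
          = Function.update (Function.update v i b) j a := h1.trans h2
      rw [h3] at h
      exact h.symm
    have Badd1 : ∀ a b c, B (a + b) c = B a c + B b c := by
      intro a b c; rw [Bsymm, Badd2, Bsymm c a, Bsymm c b]
    have Bsm1 : ∀ (r : ℝ) a b, B (r • a) b = r * B a b := by
      intro r a b; rw [Bsymm, Bsm2, Bsymm b a]
    have hunit : ∀ a, ‖a‖ = 1 → ∀ k, ‖Function.update (Function.update v i a) j a k‖ = 1 := by
      intro a ha k
      by_cases hkj : k = j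
      · subst hkj; simp [ha]
      · by_cases hki : k = i
        · subst hki; simp [hij, ha]
        · simp [hki, hkj, hv]
    have Bnorm : ∀ a, a ≠ 0 → B a a = ‖a‖ ^ 2 * B (‖a‖⁻¹ • a) (‖a‖⁻¹ • a) := by
      intro a ha
      have : ‖a‖ ≠ 0 := norm_ne_zero_iff.mpr ha
      rw [Bsm1, Bsm2]; field_simp
    have hn1 : ∀ a : E, a ≠ 0 → ‖‖a‖⁻¹ • a‖ = 1 := by
      intro a ha
      have : ‖a‖ ≠ 0 := norm_ne_zero_iff.mpr ha
      rw [norm_smul, norm_inv, norm_norm]; field_simp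
    have Bbd : ∀ a, |B a a| ≤ M * ‖a‖ ^ 2 := by
      intro a
      by_cases ha : a = 0
      · subst ha
        have := Bsm2 0 0 0
        simp at this
        simp [this]
      · rw [Bnorm a ha, abs_mul, abs_of_nonneg (sq_nonneg ‖a‖), mul_comm]
        exact mul_le_mul_of_nonneg_right (hmax _ (hunit _ (hn1 a ha))) (sq_nonneg _)
    set x := v i with hx
    set y := v j with hy
    have hBxy : |B x y| = M := by
      have : B x y = T v := by simp [B, hx, hy]
      rw [this, hvM]
    have hpol : 4 * B x y = B (x + y) (x + y) - B (x + (-1 : ℝ) • y) (x + (-1 : ℝ) • y) := by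
      simp only [Badd1, Badd2, Bsm1, Bsm2]
      rw [Bsymm y x]; ring
    have hxn : ‖x‖ = 1 := hv i
    have hyn : ‖y‖ = 1 := hv j
    have n1 : ‖x + y‖ ^ 2 = 2 + 2 * inner ℝ x y := by
      rw [norm_add_sq_real, hxn, hyn]; ring
    have n2 : ‖x + (-1 : ℝ) • y‖ ^ 2 = 2 - 2 * inner ℝ x y := by
      rw [norm_add_sq_real, norm_smul, inner_smul_right, hxn, hyn]; norm_num; ring
    have hlow : M * ‖x + y‖ ^ 2 ≤ |B (x + y) (x + y)| := by
      have b2 := Bbd (x + (-1 : ℝ) • y)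
      have h4 : 4 * M ≤ |B (x + y) (x + y)| + |B (x + (-1 : ℝ) • y) (x + (-1 : ℝ) • y)| := by
        rw [← hBxy]
        calc 4 * |B x y| = |4 * B x y| := by rw [abs_mul]; norm_num
          _ ≤ _ := by rw [hpol]; exact abs_sub _ _
      rw [n2] at b2
      rw [n1]
      linarith
    have hin : 2 ≤ inner ℝ S (x + y) := by
      rw [inner_add_right]; have := hSv i; have := hSv j; linarith
    have hs0 : x + y ≠ 0 := by
      intro h; rw [h, inner_zero_right] at hin; linarith
    have hr : 0 < ‖x + y‖ := norm_pos_iff.mpr hs0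
    have hr2 : ‖x + y‖ < 2 := by
      have h3 : 0 < ‖x - y‖ := norm_pos_iff.mpr (sub_ne_zero.mpr hne)
      have h4 : ‖x - y‖ ^ 2 = 2 - 2 * inner ℝ x y := by
        rw [norm_sub_sq_real, hxn, hyn]; ring
      nlinarith
    have hBw : |B (‖x + y‖⁻¹ • (x + y)) (‖x + y‖⁻¹ • (x + y))| = M := by
      apply le_antisymm
      · exact hmax _ (hunit _ (hn1 _ hs0))
      · rw [Bnorm _ hs0, abs_mul, abs_of_nonneg (sq_nonneg ‖x + y‖), mul_comm] at hlow
        exact le_of_mul_le_mul_left hlow (by positivity)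
    have hfin := hpot _ (hunit _ (hn1 _ hs0)) hBw
    rw [aux_sum_update, aux_sum_update, ← hS, Function.update_of_ne hij.symm, ← hx, ← hy] at hfin
    have e2 : S - x + ‖x + y‖⁻¹ • (x + y) - y + ‖x + y‖⁻¹ • (x + y)
        = S + (2 * ‖x + y‖⁻¹ - 1) • (x + y) := by
      module
    have hc : 0 < 2 * ‖x + y‖⁻¹ - 1 := by
      have : 1 < 2 / ‖x + y‖ := by rw [lt_div_iff₀ hr]; linarith
      rw [div_eq_mul_inv] at this; linarith
    rw [e2, norm_add_sq_real, inner_smul_right] at hfin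
    have := mul_pos hc (lt_of_lt_of_le two_pos hin)
    have := sq_nonneg ‖(2 * ‖x + y‖⁻¹ - 1) • (x + y)‖
    linarith
  refine ⟨v ⟨0, hm⟩, hv _, fun w hw => ?_⟩
  have : (fun _ => v ⟨0, hm⟩) = v := funext fun k => key _ _
  rw [this, hvM]
  exact hmax w hw

/-- A symmetric tensor `F ∈ S^m(ℝ^n)` has a best rank-1 approximation that is a
symmetric rank-1 tensor `λ·u^{⊗m}`: it minimizes `‖F − μ·v¹⊗⋯⊗v^m‖` over all `μ ∈ ℝ`
and all (not necessarily equal) unit vectors `v¹,…,v^m ∈ ℝ^n`. -/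
theorem stmt_3 (m n : ℕ) (hm : 0 < m) (hn : 0 < n)
    (F : (Fin m → Fin n) → ℝ)
    (hsym : ∀ (i : Fin m → Fin n) (σ : Equiv.Perm (Fin m)), F (i ∘ σ) = F i) :
    ∃ (lam : ℝ) (u : Fin n → ℝ),
      (∑ k, (u k) ^ 2 = 1) ∧
      ∀ (μ : ℝ) (v : Fin m → (Fin n → ℝ)), (∀ j, ∑ k, (v j k) ^ 2 = 1) →
        ∑ i : Fin m → Fin n, (F i - lam * ∏ j, u (i j)) ^ 2 ≤
          ∑ i : Fin m → Fin n, (F i - μ * ∏ j, v j (i j)) ^ 2 := by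
  have : Nonempty (Fin n) := ⟨⟨0, hn⟩⟩
  have : Nontrivial (EuclideanSpace ℝ (Fin n)) := by
    refine ⟨⟨EuclideanSpace.single ⟨0, hn⟩ 1, 0, fun h => ?_⟩⟩
    have := congrArg (fun x : EuclideanSpace ℝ (Fin n) => x ⟨0, hn⟩) h
    simp at this
  let T : MultilinearMap ℝ (fun _ : Fin m => EuclideanSpace ℝ (Fin n)) ℝ :=
    ∑ i : Fin m → Fin n, F i • (MultilinearMap.mkPiAlgebra ℝ (Fin m) ℝ).compLinearMap
      (fun j => (EuclideanSpace.proj (i j) : EuclideanSpace ℝ (Fin n) →L[ℝ] ℝ).toLinearMap)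
  have hTa : ∀ v, T v = ∑ i : Fin m → Fin n, F i * ∏ j, v j (i j) := by
    intro v
    simp [T]
  have hTc : Continuous T := by
    have : (T : (Fin m → EuclideanSpace ℝ (Fin n)) → ℝ)
      = fun v => ∑ i : Fin m → Fin n, F i * ∏ j, v j (i j) := funext hTa
    rw [this]
    fun_prop
  obtain ⟨u, hu, hmax⟩ := aux_banach hm T hTc (by
    intro v σ
    rw [hTa, hTa]
    refine Fintype.sum_equiv (Equiv.arrowCongr σ (Equiv.refl _)) _ _ fun i => ?_
    have e1 : (Equiv.arrowCongr σ (Equiv.refl (Fin n))) i = i ∘ σ.symm := rfl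
    rw [e1, hsym i σ.symm]
    congr 1
    exact Fintype.prod_equiv σ _ _ fun j => by simp)
  have hnorm : ∀ x : EuclideanSpace ℝ (Fin n), ‖x‖ ^ 2 = ∑ k, (x k) ^ 2 := by
    intro x; rw [EuclideanSpace.norm_sq_eq]; simp
  have hexp : ∀ (μ : ℝ) (v : Fin m → (Fin n → ℝ)), (∀ j, ∑ k, (v j k) ^ 2 = 1) →
      ∑ i : Fin m → Fin n, (F i - μ * ∏ j, v j (i j)) ^ 2
        = ∑ i, F i ^ 2 - 2 * μ * (∑ i : Fin m → Fin n, F i * ∏ j, v j (i j)) + μ ^ 2 := by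
    intro μ v hv
    have h1 : ∑ i : Fin m → Fin n, (∏ j, v j (i j)) ^ 2 = 1 := by
      simp_rw [← Finset.prod_pow]
      rw [← Fintype.prod_sum (fun j k => v j k ^ 2)]
      simp [hv]
    calc _ = ∑ i : Fin m → Fin n, (F i ^ 2 - 2 * μ * (F i * ∏ j, v j (i j))
            + μ ^ 2 * (∏ j, v j (i j)) ^ 2) := by
          refine Finset.sum_congr rfl fun i _ => by ring
      _ = _ := by
          rw [Finset.sum_add_distrib, Finset.sum_sub_distrib, ← Finset.mul_sum, ← Finset.mul_sum,
            h1, mul_one]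
  have hu2 : ∑ k, (u k) ^ 2 = 1 := by rw [← hnorm, hu]; norm_num
  refine ⟨T fun _ => u, fun k => u k, hu2, fun μ v hv => ?_⟩
  rw [hexp μ v hv, hexp _ (fun _ k => u k) (fun _ => hu2), ← hTa (fun _ => u)]
  have h := hmax (fun j => WithLp.toLp 2 (v j)) (by
    intro j
    have h := hnorm (WithLp.toLp 2 (v j))
    simp only [hv j] at h
    have h0 := norm_nonneg (WithLp.toLp 2 (v j))
    nlinarith)
  rw [hTa (fun j => WithLp.toLp 2 (v j))] at h
  simp only at h
  have h2 := sq_le_sq.mpr h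
  nlinarith [sq_nonneg (μ - ∑ i : Fin m → Fin n, F i * ∏ j, v j (i j))]
end

section
/- Let F ∈ ℝ^{n×⋯×n} be a symmetric tensor of order m, let f(x) = F(x,…,x) be the associated degree-m form, let u ∈ ℝ^n be a unit vector and set λ = f(u). Then ‖F − λ·u^{⊗m}‖² = ‖F‖² − λ², and λ·u^{⊗m} minimizes ‖F − μ·v^{⊗m}‖ over all μ ∈ ℝ and unit vectors v ∈ ℝ^n if and only if u is a global maximizer of |f(x)| over the unit sphere {x ∈ ℝ^n : ‖x‖ = 1}. -/
open Finset

theorem expand_aux (m n : ℕ) (F : (Fin m → Fin n) → ℝ) (v : Fin n → ℝ)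
    (hv : ∑ k, (v k) ^ 2 = 1) (μ : ℝ) :
    ∑ i : Fin m → Fin n, (F i - μ * ∏ j, v (i j)) ^ 2 =
      (∑ i : Fin m → Fin n, (F i) ^ 2)
        - 2 * μ * (∑ i : Fin m → Fin n, F i * ∏ j, v (i j)) + μ ^ 2 := by
  have h1 : ∑ i : Fin m → Fin n, (∏ j, v (i j)) ^ 2 = 1 := by
    have h := Finset.sum_pow' (Finset.univ : Finset (Fin n)) (fun k => (v k) ^ 2) m
    rw [hv, one_pow] at h
    simp only [Fintype.piFinset_univ] at h
    rw [h]
    exact Finset.sum_congr rfl fun i _ => (Finset.prod_pow _ _ _).symm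
  have h2 : ∀ i : Fin m → Fin n, (F i - μ * ∏ j, v (i j)) ^ 2 =
      (F i) ^ 2 - 2 * μ * (F i * ∏ j, v (i j)) + μ ^ 2 * (∏ j, v (i j)) ^ 2 := by
    intro i; ring
  simp only [h2, Finset.sum_add_distrib, Finset.sum_sub_distrib, ← Finset.mul_sum, h1]
  ring

/-- For a symmetric tensor `F`, a unit vector `u` and `λ = f(u)` (where
`f(x) = F(x,…,x)`), one has `‖F − λ·u^{⊗m}‖² = ‖F‖² − λ²`, and `λ·u^{⊗m}` minimizes
`‖F − μ·v^{⊗m}‖` over `μ ∈ ℝ` and unit vectors `v` iff `u` globally maximizes `|f|`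
on the unit sphere. -/
theorem stmt_4 (m n : ℕ) (hm : 0 < m) (hn : 0 < n)
    (F : (Fin m → Fin n) → ℝ)
    (hsym : ∀ (i : Fin m → Fin n) (σ : Equiv.Perm (Fin m)), F (i ∘ σ) = F i)
    (u : Fin n → ℝ) (hu : ∑ k, (u k) ^ 2 = 1)
    (lam : ℝ) (hlam : lam = ∑ i : Fin m → Fin n, F i * ∏ j, u (i j)) :
    (∑ i : Fin m → Fin n, (F i - lam * ∏ j, u (i j)) ^ 2 =
        (∑ i : Fin m → Fin n, (F i) ^ 2) - lam ^ 2) ∧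
    ((∀ (μ : ℝ) (v : Fin n → ℝ), (∑ k, (v k) ^ 2 = 1) →
        ∑ i : Fin m → Fin n, (F i - lam * ∏ j, u (i j)) ^ 2 ≤
          ∑ i : Fin m → Fin n, (F i - μ * ∏ j, v (i j)) ^ 2)
      ↔ (∀ x : Fin n → ℝ, (∑ k, (x k) ^ 2 = 1) →
          |∑ i : Fin m → Fin n, F i * ∏ j, x (i j)| ≤
            |∑ i : Fin m → Fin n, F i * ∏ j, u (i j)|)) := by
  have hmain : ∑ i : Fin m → Fin n, (F i - lam * ∏ j, u (i j)) ^ 2 =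
        (∑ i : Fin m → Fin n, (F i) ^ 2) - lam ^ 2 := by
    rw [expand_aux m n F u hu, ← hlam]; ring
  refine ⟨hmain, ?_⟩
  rw [hmain, ← hlam]
  constructor
  · intro h x hx
    have h3 := h (∑ i : Fin m → Fin n, F i * ∏ j, x (i j)) x hx
    rw [expand_aux m n F x hx] at h3
    apply sq_le_sq.mp
    linarith
  · intro h μ v hv
    have h3 := sq_le_sq.mpr (h v hv)
    rw [expand_aux m n F v hv]
    nlinarith [sq_nonneg (μ - ∑ i : Fin m → Fin n, F i * ∏ j, v (i j))]
end

section
/- Let d ≥ 1 and let f be a homogeneous polynomial of odd degree m = 2d−1 in x ∈ ℝ^n. Define the form f̃ of degree 2d in (x, x_{n+1}) ∈ ℝ^{n+1} by f̃(x, x_{n+1}) = f(x)·x_{n+1}. Then max_{x ∈ ℝ^n, ‖x‖=1} f(x) = √(2d−1)·(1 − 1/(2d))^{−d} · max_{(x,x_{n+1}) ∈ ℝ^{n+1}, ‖(x,x_{n+1})‖=1} f̃(x, x_{n+1}). -/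
open Finset

lemma aux_ineq (m : ℕ) (v : ℝ) (hv : 0 ≤ v) : v ^ m * (m + 1 - m * v) ≤ 1 := by
  induction m with
  | zero => simp
  | succ k ih =>
    refine le_trans ?_ ih
    have h : 0 ≤ v ^ k * (((k:ℝ) + 1) * (v - 1) ^ 2) := by positivity
    push_cast
    rw [pow_succ]
    nlinarith [h]

lemma aux_hom {n m : ℕ} (f : MvPolynomial (Fin n) ℝ) (hf : f.IsHomogeneous m) (c : ℝ)
    (x : Fin n → ℝ) : MvPolynomial.eval (fun i => c * x i) f = c ^ m * MvPolynomial.eval x f := by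
  rw [MvPolynomial.eval_eq, MvPolynomial.eval_eq, Finset.mul_sum]
  refine Finset.sum_congr rfl fun e he => ?_
  have h1 : ∑ i ∈ e.support, e i = m := by
    have := hf (MvPolynomial.mem_support_iff.mp he)
    rw [← this, Finsupp.weight_apply, Finsupp.sum]
    simp
  simp_rw [mul_pow]
  rw [Finset.prod_mul_distrib, Finset.prod_pow_eq_pow_sum, h1]
  ring

lemma aux_bound (k : ℕ) (S t : ℝ) (hS : 0 ≤ S) (h : S + t ^ 2 = 1) :
    Real.sqrt S ^ (2 * k + 1) * |t| ≤
      (1 - 1 / (2 * ((k:ℝ) + 1))) ^ (k + 1) / Real.sqrt (2 * ((k:ℝ) + 1) - 1) := by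
  have hm : (0:ℝ) < 2 * ((k:ℝ) + 1) - 1 := by
    have : (0:ℝ) ≤ k := by positivity
    linarith
  have hq : 1 - 1 / (2 * ((k:ℝ) + 1)) = (2 * (k:ℝ) + 1) / (2 * ((k:ℝ) + 1)) := by
    field_simp; ring
  have hm' : 2 * ((k:ℝ) + 1) - 1 = 2 * k + 1 := by ring
  refine (fun h1 h2 => abs_le_of_sq_le_sq' h2 h1 |>.2) ?_ ?_
  · rw [hq]; positivity
  rw [mul_pow, sq_abs, ← pow_mul, mul_comm (2 * k + 1) 2, pow_mul, Real.sq_sqrt hS, div_pow,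
    Real.sq_sqrt hm.le, hq, hm', ← pow_mul]
  have key := aux_ineq (2 * k + 1) ((2 * k + 2) * S / (2 * k + 1)) (by positivity)
  have e1 : (((2 * k + 1 : ℕ) : ℝ) + 1 - ((2 * k + 1 : ℕ) : ℝ) * ((2 * k + 2) * S / (2 * k + 1)))
      = (2 * k + 2) * t ^ 2 := by
    have : t ^ 2 = 1 - S := by linarith
    rw [this]; push_cast; field_simp; ring
  rw [e1, div_pow, mul_pow] at key
  have hp : (0:ℝ) < (2 * k + 1) ^ (2 * k + 1) := by positivity
  have hp2 : (0:ℝ) < (2 * k + 2) ^ (2 * k + 2) := by positivity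
  have e2 : ((2 * (k:ℝ) + 1) / (2 * ((k:ℝ) + 1))) ^ ((k + 1) * 2) / (2 * k + 1)
      = (2 * (k:ℝ) + 1) ^ (2 * k + 1) / (2 * k + 2) ^ (2 * k + 2) := by
    rw [div_pow, show (k + 1) * 2 = 2 * k + 1 + 1 by ring, pow_succ (2 * (k:ℝ) + 1),
      show 2 * ((k:ℝ) + 1) = 2 * k + 2 by ring]
    field_simp
  rw [e2, le_div_iff₀ hp2]
  rw [div_mul_eq_mul_div, div_le_one hp] at key
  refine le_trans (le_of_eq ?_) key
  ring

theorem stmt_6 (n d : ℕ) (hn : 1 ≤ n) (hd : 1 ≤ d)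
    (f : MvPolynomial (Fin n) ℝ) (hf : f.IsHomogeneous (2 * d - 1)) :
    ∃ a b : ℝ,
      IsGreatest {r : ℝ | ∃ x : Fin n → ℝ, ∑ i, (x i) ^ 2 = 1 ∧
        MvPolynomial.eval x f = r} a ∧
      IsGreatest {r : ℝ | ∃ x : Fin (n + 1) → ℝ, ∑ i, (x i) ^ 2 = 1 ∧
        (MvPolynomial.eval (fun j : Fin n => x j.castSucc) f) * x (Fin.last n) = r} b ∧
      a = Real.sqrt (2 * (d : ℝ) - 1) * (1 - 1 / (2 * (d : ℝ))) ^ (-(d : ℤ)) * b := by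
  obtain ⟨k, rfl⟩ : ∃ k, d = k + 1 := ⟨d - 1, by omega⟩
  have hdeg : 2 * (k + 1) - 1 = 2 * k + 1 := by omega
  rw [hdeg] at hf
  have hcpt : IsCompact {x : Fin n → ℝ | ∑ i, (x i) ^ 2 = 1} := by
    refine Metric.isCompact_of_isClosed_isBounded ?_ ?_
    · exact isClosed_eq (by fun_prop) continuous_const
    · refine (Metric.isBounded_closedBall (x := (0 : Fin n → ℝ)) (r := 1)).subset ?_
      intro x hx
      rw [mem_closedBall_zero_iff, pi_norm_le_iff_of_nonneg zero_le_one]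
      intro i
      have h1 : (x i) ^ 2 ≤ ∑ i, (x i) ^ 2 :=
        Finset.single_le_sum (f := fun i => (x i) ^ 2) (fun i _ => sq_nonneg _) (Finset.mem_univ i)
      rw [Set.mem_setOf_eq] at hx
      rw [hx] at h1
      rw [Real.norm_eq_abs]
      exact (sq_le_one_iff_abs_le_one _).mp h1
  have hne : {x : Fin n → ℝ | ∑ i, (x i) ^ 2 = 1}.Nonempty := by
    refine ⟨Pi.single ⟨0, hn⟩ 1, ?_⟩
    rw [Set.mem_setOf_eq, Finset.sum_eq_single ⟨0, hn⟩]
    · simp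
    · intro b _ hb
      simp [Pi.single_eq_of_ne hb]
    · simp
  obtain ⟨x0, hx0, hmax⟩ := hcpt.exists_isMaxOn hne
    (f := fun x => MvPolynomial.eval x f) (MvPolynomial.continuous_eval f).continuousOn
  rw [Set.mem_setOf_eq] at hx0
  have hmax' : ∀ x : Fin n → ℝ, ∑ i, (x i) ^ 2 = 1 →
      MvPolynomial.eval x f ≤ MvPolynomial.eval x0 f := fun x hx => hmax hx
  have habs : ∀ x : Fin n → ℝ, ∑ i, (x i) ^ 2 = 1 →
      |MvPolynomial.eval x f| ≤ MvPolynomial.eval x0 f := by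
    intro x hx
    refine abs_le.mpr ⟨?_, hmax' x hx⟩
    have h1 := hmax' (fun i => (-1) * x i) (by simpa using hx)
    rw [aux_hom f hf] at h1
    have : (-1 : ℝ) ^ (2 * k + 1) = -1 := Odd.neg_one_pow ⟨k, rfl⟩
    rw [this] at h1
    linarith
  set a := MvPolynomial.eval x0 f with ha
  have ha0 : 0 ≤ a := (abs_nonneg _).trans (habs x0 hx0)
  have hm : (0:ℝ) < 2 * ((k:ℝ) + 1) - 1 := by
    have : (0:ℝ) ≤ k := by positivity
    linarith
  have hq : 1 - 1 / (2 * ((k:ℝ) + 1)) = (2 * ((k:ℝ) + 1) - 1) / (2 * ((k:ℝ) + 1)) := by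
    field_simp
  have hqpos : 0 < 1 - 1 / (2 * ((k:ℝ) + 1)) := by rw [hq]; positivity
  have hsm := Real.sqrt_pos.mpr hm
  refine ⟨a, a * ((1 - 1 / (2 * ((k:ℝ) + 1))) ^ (k + 1) / Real.sqrt (2 * ((k:ℝ) + 1) - 1)),
    ⟨⟨x0, hx0, rfl⟩, ?_⟩, ⟨?_, ?_⟩, ?_⟩
  · rintro r ⟨x, hx, rfl⟩
    exact hmax' x hx
  · refine ⟨Fin.snoc (α := fun _ => ℝ) (fun i => Real.sqrt (1 - 1 / (2 * ((k:ℝ) + 1))) * x0 i)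
      (1 / Real.sqrt (2 * ((k:ℝ) + 1))), ?_, ?_⟩
    · rw [Fin.sum_univ_castSucc]
      simp only [Fin.snoc_castSucc, Fin.snoc_last, mul_pow]
      rw [← Finset.mul_sum, hx0, Real.sq_sqrt hqpos.le, div_pow, Real.sq_sqrt (by positivity)]
      ring
    · simp only [Fin.snoc_castSucc, Fin.snoc_last]
      rw [aux_hom f hf, ← ha, pow_succ, pow_mul, Real.sq_sqrt hqpos.le, pow_succ]
      have e : Real.sqrt (1 - 1 / (2 * ((k:ℝ) + 1))) =
        Real.sqrt (2 * ((k:ℝ) + 1) - 1) / Real.sqrt (2 * ((k:ℝ) + 1)) := by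
        rw [hq, Real.sqrt_div hm.le]
      have e3 : 1 - 1 / (2 * ((k:ℝ) + 1)) = Real.sqrt (2 * ((k:ℝ) + 1) - 1) ^ 2 /
          Real.sqrt (2 * ((k:ℝ) + 1)) ^ 2 := by
        rw [Real.sq_sqrt hm.le, Real.sq_sqrt (by positivity), hq]
      have hs2 : 0 < Real.sqrt (2 * ((k:ℝ) + 1)) := Real.sqrt_pos.mpr (by positivity)
      rw [e]
      generalize (1 - 1 / (2 * ((k:ℝ) + 1))) ^ k = Q
      rw [e3]
      field_simp
  · rintro r ⟨x, hx, rfl⟩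
    rw [Fin.sum_univ_castSucc] at hx
    set S := ∑ i : Fin n, (x i.castSucc) ^ 2 with hS
    have hS0 : 0 ≤ S := Finset.sum_nonneg fun i _ => sq_nonneg _
    have hb := aux_bound k S (x (Fin.last n)) hS0 hx
    have hy : |MvPolynomial.eval (fun j : Fin n => x j.castSucc) f| ≤
        a * Real.sqrt S ^ (2 * k + 1) := by
      rcases hS0.eq_or_lt with h0 | h0
      · have hz : ∀ i : Fin n, x i.castSucc = 0 := by
          intro i
          have := (Finset.sum_eq_zero_iff_of_nonneg
            (fun (i : Fin n) _ => sq_nonneg (x i.castSucc))).mp (hS.symm.trans h0.symm) i (Finset.mem_univ i)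
          exact pow_eq_zero_iff (two_ne_zero) |>.mp this
        have := aux_hom f hf 0 (fun j : Fin n => x j.castSucc)
        simp only [zero_mul] at this
        simp only [hz]
        rw [this]
        simp
        positivity
      · have hs := Real.sqrt_pos.mpr h0
        have h1 := habs (fun i => (Real.sqrt S)⁻¹ * x i.castSucc) (by
          simp only [mul_pow]
          rw [← Finset.mul_sum, ← hS, inv_pow, Real.sq_sqrt hS0, inv_mul_cancel₀ h0.ne'])
        rw [aux_hom f hf _ (fun i : Fin n => x i.castSucc), abs_mul, abs_of_pos (by positivity),
          inv_pow, inv_mul_le_iff₀ (by positivity)] at h1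
        linarith
    calc _ ≤ |MvPolynomial.eval (fun j : Fin n => x j.castSucc) f * x (Fin.last n)| := le_abs_self _
      _ = |MvPolynomial.eval (fun j : Fin n => x j.castSucc) f| * |x (Fin.last n)| := abs_mul _ _
      _ ≤ a * Real.sqrt S ^ (2 * k + 1) * |x (Fin.last n)| := by gcongr
      _ = a * (Real.sqrt S ^ (2 * k + 1) * |x (Fin.last n)|) := by ring
      _ ≤ _ := by gcongr
  · rw [zpow_neg, zpow_natCast]
    push_cast
    have := pow_pos hqpos (k + 1)
    generalize (1 - 1 / (2 * ((k:ℝ) + 1))) ^ (k + 1) = Q at *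
    field_simp
end

section
/- Let n ≥ 1, d ≥ 1, m = 2d, and let g be the form (x₁²+⋯+x_n²)^d. For every y ∈ ℝ^{ℕ^n_m} with M(y) ⪰ 0, one has Trace M(y) ≤ ⟨g, y⟩. Consequently, the feasible set {y ∈ ℝ^{ℕ^n_m} : M(y) ⪰ 0, ⟨g, y⟩ = 1} is compact. -/
open Finset MvPolynomial

/-- `ℕ^n_d`: exponent tuples `α ∈ ℕ^n` with `|α| = d`. -/
def DegTuple (n d : ℕ) : Type := {α : Fin n → ℕ // ∑ i, α i = d}

instance (n d : ℕ) : Fintype (DegTuple n d) :=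
  Fintype.ofFinset (Finset.Nat.antidiagonalTuple n d)
    (fun _ => Finset.Nat.mem_antidiagonalTuple)

instance (n d : ℕ) : DecidableEq (DegTuple n d) := fun a b =>
  decidable_of_iff (a.1 = b.1) Subtype.ext_iff.symm

/-- The moment matrix `M(y)`, indexed by `ℕ^n_d`, with entries `M(y)_{α,β} = y_{α+β}`. -/
def momMat (n d : ℕ) (y : DegTuple n (2 * d) → ℝ) :
    Matrix (DegTuple n d) (DegTuple n d) ℝ :=
  Matrix.of fun α β => y ⟨fun i => α.1 i + β.1 i, by
    rw [Finset.sum_add_distrib, α.2, β.2, two_mul]⟩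

/-- The pairing `⟨p, y⟩ = ∑_{α ∈ ℕ^n_m} p_α y_α` between a polynomial (through its
degree-`m` coefficients) and `y ∈ ℝ^{ℕ^n_m}`. -/
noncomputable def mpair {n m : ℕ} (p : MvPolynomial (Fin n) ℝ)
    (y : DegTuple n m → ℝ) : ℝ :=
  ∑ α : DegTuple n m, MvPolynomial.coeff (Finsupp.equivFunOnFinite.symm α.1) p * y α

/-- The form `g = (x₁² + ⋯ + x_n²)^d`. -/
noncomputable def gform (n d : ℕ) : MvPolynomial (Fin n) ℝ :=
  (∑ i : Fin n, (X i) ^ 2) ^ d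

lemma exists_sub_tuple {n : ℕ} (β : Fin n → ℕ) (k : ℕ) (hk : k ≤ ∑ i, β i) :
    ∃ γ : Fin n → ℕ, (∀ i, γ i ≤ β i) ∧ ∑ i, γ i = k := by
  induction k with
  | zero => exact ⟨fun _ => 0, by simp, by simp⟩
  | succ k ih =>
    obtain ⟨γ, h1, h2⟩ := ih (by omega)
    have : ∃ i, γ i < β i := by
      by_contra! h
      have := Finset.sum_le_sum (s := Finset.univ) (fun i _ => h i)
      omega
    obtain ⟨i, hi⟩ := this
    refine ⟨γ + Pi.single i 1, fun j => ?_, ?_⟩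
    · by_cases hj : j = i
      · subst hj; simpa using hi
      · simpa [hj] using h1 j
    · simp [Finset.sum_add_distrib, h2]

lemma gform_eq (n d : ℕ) : gform n d = ∑ α : DegTuple n d,
    monomial (Finsupp.equivFunOnFinite.symm (fun i => α.1 i + α.1 i))
      ((Nat.multinomial Finset.univ α.1 : ℕ) : ℝ) := by
  unfold gform
  rw [Finset.sum_pow_eq_sum_piAntidiag]
  symm
  refine Finset.sum_bij (fun α _ => α.1) ?_ ?_ ?_ ?_
  · intro α _
    simpa using α.2
  · intro a _ b _ h
    exact Subtype.ext h
  · intro b hb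
    exact ⟨⟨b, by simpa using hb⟩, Finset.mem_univ _, rfl⟩
  · intro α _
    rw [monomial_eq, Finsupp.prod_fintype _ _ (by simp)]
    simp [← pow_mul, two_mul]

lemma mpair_gform (n d : ℕ) (y : DegTuple n (2 * d) → ℝ) :
    mpair (gform n d) y = ∑ α : DegTuple n d,
      ((Nat.multinomial Finset.univ α.1 : ℕ) : ℝ) * momMat n d y α α := by
  unfold mpair
  simp_rw [gform_eq, coeff_sum, Finset.sum_mul]
  rw [Finset.sum_comm]
  refine Finset.sum_congr rfl fun α _ => ?_
  refine (Finset.sum_eq_single (⟨fun i => α.1 i + α.1 i, by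
    rw [Finset.sum_add_distrib, α.2, two_mul]⟩ : DegTuple n (2 * d)) ?_ ?_).trans ?_
  · intro b _ hb
    rw [coeff_monomial, if_neg, zero_mul]
    intro h
    exact hb (Subtype.ext (Finsupp.equivFunOnFinite.symm.injective h).symm)
  · exact fun h => absurd (Finset.mem_univ (α := DegTuple n (2 * d)) _) h
  · simp [momMat]

lemma trace_le (n d : ℕ) (y : DegTuple n (2 * d) → ℝ) (h : (momMat n d y).PosSemidef) :
    (momMat n d y).trace ≤ mpair (gform n d) y := by
  rw [mpair_gform, Matrix.trace]
  refine Finset.sum_le_sum fun α _ => ?_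
  have h1 : (1 : ℝ) ≤ ((Nat.multinomial Finset.univ α.1 : ℕ) : ℝ) := by
    exact_mod_cast Nat.multinomial_pos _ _
  have h2 := h.diag_nonneg (i := α)
  simp only [Matrix.diag_apply]
  nlinarith

lemma abs_entry_le {ι : Type*} [Fintype ι] [DecidableEq ι] (M : Matrix ι ι ℝ)
    (h : M.PosSemidef) (a b : ι) : |M a b| ≤ M.trace := by
  have hs : M b a = M a b := by simpa using h.isHermitian.apply a b
  have hp := h.dotProduct_mulVec_nonneg (Pi.single a 1 + Pi.single b 1)
  have hm := h.dotProduct_mulVec_nonneg (Pi.single a 1 - Pi.single b 1)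
  simp [Matrix.mulVec_add, Matrix.mulVec_sub, add_dotProduct, sub_dotProduct, dotProduct_add,
    dotProduct_sub] at hp hm
  have ht : ∀ c, M c c ≤ M.trace := fun c =>
    Finset.single_le_sum (f := fun c => M c c) (fun i _ => h.diag_nonneg) (Finset.mem_univ c)
  have ha := ht a
  have hb := ht b
  rw [abs_le]
  constructor <;> linarith

lemma abs_y_le (n d : ℕ) (y : DegTuple n (2 * d) → ℝ) (h : (momMat n d y).PosSemidef)
    (β : DegTuple n (2 * d)) : |y β| ≤ (momMat n d y).trace := by
  obtain ⟨γ, h1, h2⟩ := exists_sub_tuple β.1 d (by rw [β.2]; omega)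
  have h3 : ∑ i, (β.1 i - γ i) = d := by
    rw [Finset.sum_tsub_distrib _ (fun i _ => h1 i), β.2, h2]; omega
  have := abs_entry_le _ h ⟨γ, h2⟩ ⟨fun i => β.1 i - γ i, h3⟩
  convert this using 2
  simp only [momMat, Matrix.of_apply]
  congr 1
  apply Subtype.ext
  funext i
  have := h1 i
  simp only
  omega

lemma continuous_momMat (n d : ℕ) : Continuous (momMat n d) := by
  refine continuous_matrix fun i j => ?_
  simp only [momMat, Matrix.of_apply]
  exact continuous_apply _

/-- For every `y` with `M(y) ⪰ 0`, `Trace M(y) ≤ ⟨g, y⟩`; consequently the feasible set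
`{y : M(y) ⪰ 0, ⟨g, y⟩ = 1}` is compact. -/
theorem stmt_8 (n d : ℕ) (hn : 1 ≤ n) (hd : 1 ≤ d) :
    (∀ y : DegTuple n (2 * d) → ℝ, (momMat n d y).PosSemidef →
        (momMat n d y).trace ≤ mpair (gform n d) y) ∧
    IsCompact {y : DegTuple n (2 * d) → ℝ |
      (momMat n d y).PosSemidef ∧ mpair (gform n d) y = 1} := by
  refine ⟨trace_le n d, ?_⟩
  refine Metric.isCompact_of_isClosed_isBounded ?_ ?_
  · refine IsClosed.inter ?_ ?_
    · have hc := continuous_momMat n d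
      have he : {y : DegTuple n (2 * d) → ℝ | (momMat n d y).PosSemidef} =
          {y | (momMat n d y).conjTranspose = momMat n d y} ∩
          ⋂ x : DegTuple n d → ℝ, {y | 0 ≤ star x ⬝ᵥ ((momMat n d y).mulVec x)} := by
        ext y
        simp only [Set.mem_setOf_eq, Set.mem_inter_iff, Set.mem_iInter]
        exact Matrix.posSemidef_iff_dotProduct_mulVec
      change IsClosed {y : DegTuple n (2 * d) → ℝ | (momMat n d y).PosSemidef}
      rw [he]
      refine IsClosed.inter (isClosed_eq hc.matrix_conjTranspose hc) ?_
      refine isClosed_iInter fun x => isClosed_le continuous_const ?_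
      exact continuous_const.dotProduct (hc.matrix_mulVec continuous_const)
    · refine isClosed_eq ?_ continuous_const
      unfold mpair
      fun_prop
  · refine (Metric.isBounded_closedBall (x := (0 : DegTuple n (2 * d) → ℝ)) (r := 1)).subset ?_
    rintro y ⟨h1, h2⟩
    rw [mem_closedBall_zero_iff, pi_norm_le_iff_of_nonneg zero_le_one]
    intro β
    rw [Real.norm_eq_abs]
    exact (abs_y_le n d y h1 β).trans (h2 ▸ trace_le n d y h1)
end

section
/- Let n ≥ 1, d ≥ 1, m = 2d and g = (x₁²+⋯+x_n²)^d. Let y ∈ ℝ^{ℕ^n_m} satisfy M(y) ⪰ 0, ⟨g, y⟩ = 1 and rank M(y) = 1. Then there exists a unit vector v ∈ ℝ^n such that y_α = v^α for all α ∈ ℕ^n_m. -/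
open Finset MvPolynomial

lemma aux_split {n d : ℕ} (i : Fin n) (α : Fin n → ℕ) (h : ∑ k, α k = d) :
    α = Pi.single i d ∨ ∃ j, j ≠ i ∧ ∃ β : Fin n → ℕ, α = β + Pi.single j 1 := by
  by_cases hj : ∃ j, j ≠ i ∧ α j ≠ 0
  · obtain ⟨j, hji, hj⟩ := hj
    refine Or.inr ⟨j, hji, α - Pi.single j 1, ?_⟩
    funext k
    by_cases hk : k = j
    · subst hk
      simp
      omega
    · simp [hk]
  · push Not at hj
    left
    have h1 : ∑ k, α k = α i := Finset.sum_eq_single i (fun b _ hb => hj b hb) (by simp)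
    funext k
    by_cases hk : k = i
    · subst hk
      simp
      omega
    · simp [hk, hj k hk]

lemma aux_pull {n : ℕ} (i : Fin n) (α : Fin n → ℕ) (h : 0 < α i) :
    ∃ β : Fin n → ℕ, α = β + Pi.single i 1 := by
  refine ⟨α - Pi.single i 1, ?_⟩
  funext k
  by_cases hk : k = i
  · subst hk
    simp
    omega
  · simp [hk]

lemma aux_sum_add {n : ℕ} (β : Fin n → ℕ) (j : Fin n) (c : ℕ) :
    ∑ k, (β + Pi.single j c : Fin n → ℕ) k = ∑ k, β k + c := by
  simp [Finset.sum_add_distrib, Finset.sum_pi_single']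

lemma aux_sum_single {n : ℕ} (j : Fin n) (c : ℕ) :
    ∑ k, (Pi.single j c : Fin n → ℕ) k = c := by
  simp

lemma aux_decomp {n : ℕ} (γ : Fin n → ℕ) (d e : ℕ) (h : ∑ k, γ k = d + e) :
    ∃ α β : Fin n → ℕ, γ = α + β ∧ ∑ k, α k = d ∧ ∑ k, β k = e := by
  induction d generalizing e with
  | zero => exact ⟨0, γ, by simp, by simp, by simpa using h⟩
  | succ d ih =>
    obtain ⟨α, β, h1, h2, h3⟩ := ih (e + 1) (by omega)
    have : ∃ j, 0 < β j := by
      by_contra hc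
      push Not at hc
      have : ∑ k, β k = 0 := Finset.sum_eq_zero (fun k _ => by have := hc k; omega)
      omega
    obtain ⟨j, hj⟩ := this
    obtain ⟨δ, rfl⟩ := aux_pull j β hj
    rw [aux_sum_add] at h3
    refine ⟨α + Pi.single j 1, δ, ?_, ?_, by omega⟩
    · rw [h1]; abel
    · rw [aux_sum_add, h2]

lemma aux_pow {n : ℕ} (u : Fin n → ℝ) (β : Fin n → ℕ) (j : Fin n) :
    ∏ k, u k ^ (β + Pi.single j 1 : Fin n → ℕ) k = (∏ k, u k ^ β k) * u j := by
  simp only [Pi.add_apply, pow_add, Finset.prod_mul_distrib]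
  congr 1
  rw [Finset.prod_eq_single j]
  · simp
  · intro b _ hb
    simp [hb]
  · simp

lemma aux_nonzero {n d : ℕ} (W : (Fin n → ℕ) → ℝ)
    (hW : ∀ α β γ δ : Fin n → ℕ, ∑ k, α k = d → ∑ k, β k = d → ∑ k, γ k = d → ∑ k, δ k = d →
      α + β = γ + δ → W α * W β = W γ * W δ) (i : Fin n) :
    ∀ (r : ℕ) (α : Fin n → ℕ), ∑ k, α k = d → W α ≠ 0 → 0 < α i → d - α i = r →
      W (Pi.single i d) ≠ 0 := by
  intro r
  induction r using Nat.strong_induction_on with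
  | _ r ih =>
    intro α hs hα hi hr
    rcases aux_split i α hs with h | ⟨j, hji, β, hβ⟩
    · rwa [← h]
    · obtain ⟨δ, hδ⟩ := aux_pull i α hi
      have s1 : ∑ k, β k + 1 = d := by rw [← hs, hβ, aux_sum_add]
      have s2 : ∑ k, δ k + 1 = d := by rw [← hs, hδ, aux_sum_add]
      have hp := hW α α (β + Pi.single i 1) (δ + Pi.single j 1) hs hs
        (by rw [aux_sum_add, s1]) (by rw [aux_sum_add, s2])
        (by
          nth_rewrite 1 [hβ]
          nth_rewrite 1 [hδ]
          abel)
      have hb : α i = β i := by rw [hβ]; simp [Ne.symm hji]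
      have hle : β i ≤ ∑ k, β k := Finset.single_le_sum (fun _ _ => Nat.zero_le _) (mem_univ i)
      refine ih (d - (β i + 1)) (by omega) (β + Pi.single i 1) (by rw [aux_sum_add, s1]) ?_ ?_ ?_
      · intro h0
        rw [h0, zero_mul] at hp
        exact hα (mul_self_eq_zero.mp hp)
      · simp
      · simp

lemma aux_form {n d : ℕ} (hd : 1 ≤ d) (W : (Fin n → ℕ) → ℝ)
    (hW : ∀ α β γ δ : Fin n → ℕ, ∑ k, α k = d → ∑ k, β k = d → ∑ k, γ k = d → ∑ k, δ k = d →
      α + β = γ + δ → W α * W β = W γ * W δ)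
    (α0 : Fin n → ℕ) (h0 : ∑ k, α0 k = d) (hne : W α0 ≠ 0) :
    ∃ (c : ℝ) (u : Fin n → ℝ), c ≠ 0 ∧
      ∀ α : Fin n → ℕ, ∑ k, α k = d → W α = c * ∏ k, u k ^ α k := by
  have : ∃ i, 0 < α0 i := by
    by_contra hc
    push Not at hc
    have : ∑ k, α0 k = 0 := Finset.sum_eq_zero (fun k _ => by have := hc k; omega)
    omega
  obtain ⟨i, hi⟩ := this
  have hc := aux_nonzero W hW i _ α0 h0 hne hi rfl
  set c := W (Pi.single i d) with hcdef
  obtain ⟨e, rfl⟩ : ∃ e, d = e + 1 := ⟨d - 1, by omega⟩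
  set u : Fin n → ℝ := fun j => W (Pi.single i e + Pi.single j 1) / c with hu
  have hse : (Pi.single i e + Pi.single i 1 : Fin n → ℕ) = Pi.single i (e + 1) := by
    rw [← Pi.single_add]
  have hui : u i = 1 := by
    simp only [hu, hse]
    exact div_self hc
  refine ⟨c, u, hc, ?_⟩
  have key : ∀ (r : ℕ) (α : Fin n → ℕ), ∑ k, α k = e + 1 → e + 1 - α i = r →
      W α = c * ∏ k, u k ^ α k := by
    intro r
    induction r using Nat.strong_induction_on with
    | _ r ih =>
      intro α hs hr
      rcases aux_split i α hs with h | ⟨j, hji, β, hβ⟩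
      · rw [h, Finset.prod_eq_single i]
        · simp [hui, hcdef]
        · intro b _ hb
          simp [hb]
        · simp
      · have s1 : ∑ k, β k + 1 = e + 1 := by rw [← hs, hβ, aux_sum_add]
        have hp := hW α (Pi.single i (e + 1)) (β + Pi.single i 1)
          (Pi.single i e + Pi.single j 1) hs
          (aux_sum_single _ _)
          (by rw [aux_sum_add, s1]) (by rw [aux_sum_add, aux_sum_single])
          (by
            rw [hβ, ← hse]
            abel)
        have hb : α i = β i := by rw [hβ]; simp [Ne.symm hji]
        have hle : β i ≤ ∑ k, β k :=
          Finset.single_le_sum (fun _ _ => Nat.zero_le _) (mem_univ i)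
        have hI := ih (e + 1 - (β i + 1)) (by omega) (β + Pi.single i 1)
          (by rw [aux_sum_add, s1]) (by simp)
        rw [aux_pow, hui, mul_one] at hI
        rw [hI] at hp
        have huj : W (Pi.single i e + Pi.single j 1) = u j * c := by
          simp only [hu]
          field_simp
        rw [huj] at hp
        rw [hβ, aux_pow, ← hβ]
        apply mul_right_cancel₀ hc
        rw [← hcdef] at hp
        rw [hp]
        ring
  intro α hs
  exact key _ α hs rfl

lemma aux_rank {ι : Type*} [Fintype ι] [DecidableEq ι] (A : Matrix ι ι ℝ)
    (hA : A.PosSemidef) (hr : A.rank = 1) :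
    ∃ (l : ℝ) (a : ι → ℝ) (k : ι), 0 < l ∧ a k ≠ 0 ∧ ∀ i j, A i j = l * a i * a j := by
  rw [Matrix.rank_eq_finrank_span_cols, finrank_eq_one_iff'] at hr
  obtain ⟨⟨v, hv⟩, hne, hsp⟩ := hr
  have hb : ∀ j, ∃ c : ℝ, ∀ i, A i j = c * v i := by
    intro j
    obtain ⟨c, hc⟩ := hsp ⟨A.col j, Submodule.subset_span ⟨j, rfl⟩⟩
    refine ⟨c, fun i => ?_⟩
    have := congrFun (congrArg Subtype.val hc) i
    simpa using this.symm
  choose b hb using hb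
  have hv0 : v ≠ 0 := fun h => hne (Subtype.ext h)
  obtain ⟨k, hk⟩ := Function.ne_iff.mp hv0
  have hk : v k ≠ 0 := hk
  have hsym : ∀ i j, A i j = A j i := fun i j => by
    have := hA.1.apply j i
    simpa using this
  have hbv : ∀ j, b j = b k / v k * v j := by
    intro j
    have := hsym k j
    rw [hb, hb] at this
    field_simp
    linarith
  have hform : ∀ i j, A i j = (b k / v k) * v i * v j := by
    intro i j
    rw [hb, hbv]
    ring
  refine ⟨b k / v k, v, k, ?_, hk, hform⟩
  have h1 : 0 ≤ A k k := hA.diag_nonneg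
  rw [hform] at h1
  have h2 : 0 < v k * v k := mul_self_pos.mpr hk
  have h3 : 0 ≤ b k / v k := by
    by_contra hc
    push Not at hc
    nlinarith
  refine lt_of_le_of_ne h3 (fun h => hv0 ?_)
  have hz : ∀ i j, A i j = 0 := fun i j => by rw [hform, ← h]; simp
  have : Submodule.span ℝ (Set.range A.col) = ⊥ := by
    rw [Submodule.span_eq_bot]
    rintro _ ⟨j, rfl⟩
    funext i
    exact hz i j
  rw [this] at hv
  simpa using hv

lemma aux_pair (n d : ℕ) (y : DegTuple n (2 * d) → ℝ) (v : Fin n → ℝ)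
    (h : ∀ α : DegTuple n (2 * d), y α = ∏ i, v i ^ α.1 i) :
    mpair (gform n d) y = (∑ i, v i ^ 2) ^ d := by
  have hg : (gform n d).IsHomogeneous (2 * d) := by
    unfold gform
    exact (IsHomogeneous.sum _ _ _ (fun i _ => isHomogeneous_X_pow i 2)).pow d
  have he : eval v (gform n d) = (∑ i, v i ^ 2) ^ d := by
    simp [gform]
  rw [← he, eval_eq']
  unfold mpair
  refine Finset.sum_bij_ne_zero
    (fun α _ _ => Finsupp.equivFunOnFinite.symm α.1) ?_ ?_ ?_ ?_
  · intro α _ hα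
    rw [mem_support_iff]
    exact left_ne_zero_of_mul hα
  · intro a _ _ b _ _ hab
    exact Subtype.ext (Finsupp.equivFunOnFinite.symm.injective hab)
  · intro b hb hb'
    have hdeg := hg.degree_eq_sum_deg_support hb
    have hs : ∑ i, b i = 2 * d := by
      rw [hdeg]
      exact (Finset.sum_subset (Finset.subset_univ _) (fun i _ hi => by simpa using hi)).symm
    have hbb : Finsupp.equivFunOnFinite.symm (fun i => b i) = b := by
      ext i
      simp
    refine ⟨(⟨fun i => b i, hs⟩ : DegTuple n (2 * d)), mem_univ _, ?_, ?_⟩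
    · have h1 := h (⟨fun i => b i, hs⟩ : DegTuple n (2 * d))
      intro h2
      apply hb'
      erw [h1, hbb] at h2
      exact h2
    · ext i
      simp
  · intro α _ _
    rw [h]
    simp

/-- If `y` is feasible (`M(y) ⪰ 0`, `⟨g, y⟩ = 1`) and `rank M(y) = 1`, then `y` is the
moment vector `y_α = v^α` of some unit vector `v ∈ ℝ^n`. -/
theorem stmt_11 (n d : ℕ) (hn : 1 ≤ n) (hd : 1 ≤ d)
    (y : DegTuple n (2 * d) → ℝ)
    (hpsd : (momMat n d y).PosSemidef)
    (hfeas : mpair (gform n d) y = 1)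
    (hrank : (momMat n d y).rank = 1) :
    ∃ v : Fin n → ℝ, (∑ i, (v i) ^ 2 = 1) ∧
      ∀ α : DegTuple n (2 * d), y α = ∏ i, v i ^ α.1 i := by
  obtain ⟨l, a, k, hl, hk, hM⟩ := aux_rank _ hpsd hrank
  have hM' : ∀ (α β : Fin n → ℕ) (hα : ∑ i, α i = d) (hβ : ∑ i, β i = d)
      (h : ∑ i, (α + β) i = 2 * d), y ⟨α + β, h⟩ = l * a ⟨α, hα⟩ * a ⟨β, hβ⟩ := by
    intro α β hα hβ h
    exact hM ⟨α, hα⟩ ⟨β, hβ⟩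
  set W : (Fin n → ℕ) → ℝ := fun α => if h : ∑ i, α i = d then a ⟨α, h⟩ else 0 with hWdef
  have hWa : ∀ (α : Fin n → ℕ) (h : ∑ i, α i = d), W α = a ⟨α, h⟩ := by
    intro α h
    simp [hWdef, h]
  have hs2 : ∀ α β : Fin n → ℕ, ∑ i, α i = d → ∑ i, β i = d → ∑ i, (α + β) i = 2 * d := by
    intro α β hα hβ
    simp only [Pi.add_apply, Finset.sum_add_distrib, hα, hβ]
    omega
  have hW : ∀ α β γ δ : Fin n → ℕ, ∑ k, α k = d → ∑ k, β k = d → ∑ k, γ k = d →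
      ∑ k, δ k = d → α + β = γ + δ → W α * W β = W γ * W δ := by
    intro α β γ δ hα hβ hγ hδ he
    have h1 := hM' α β hα hβ (hs2 _ _ hα hβ)
    have h2 := hM' γ δ hγ hδ (hs2 _ _ hγ hδ)
    have h3 : (⟨α + β, hs2 _ _ hα hβ⟩ : DegTuple n (2 * d)) = ⟨γ + δ, hs2 _ _ hγ hδ⟩ :=
      Subtype.ext he
    rw [h3, h2] at h1
    rw [hWa α hα, hWa β hβ, hWa γ hγ, hWa δ hδ]
    apply mul_left_cancel₀ hl.ne'
    linarith
  obtain ⟨c, u, hc, hu⟩ := aux_form hd W hW k.1 k.2 (by rw [hWa k.1 k.2]; exact hk)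
  have hpos : 0 < l * c ^ 2 := by positivity
  set t : ℝ := (l * c ^ 2) ^ (((2 * d : ℕ) : ℝ)⁻¹) with ht
  have htp : t ^ (2 * d) = l * c ^ 2 := Real.rpow_inv_natCast_pow hpos.le (by omega)
  have hy : ∀ α : DegTuple n (2 * d), y α = ∏ i, (t * u i) ^ α.1 i := by
    rintro ⟨γ, hγ⟩
    obtain ⟨α, β, rfl, hα, hβ⟩ := aux_decomp γ d d (by omega)
    rw [hM' α β hα hβ hγ, ← hWa α hα, ← hWa β hβ, hu α hα, hu β hβ]
    simp only [mul_pow, Finset.prod_mul_distrib]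
    rw [Finset.prod_pow_eq_pow_sum, hγ, htp]
    simp only [Pi.add_apply, pow_add, Finset.prod_mul_distrib]
    ring
  refine ⟨fun i => t * u i, ?_, hy⟩
  have hp := aux_pair n d y _ hy
  rw [hfeas] at hp
  exact (pow_eq_one_iff_of_nonneg (Finset.sum_nonneg (fun i _ => sq_nonneg _)) (by omega)).mp hp.symm
end

section
/- Let n ≥ 2, d ≥ 1, m = 2d, let f be a form of degree m in n variables and g = (x₁²+⋯+x_n²)^d. Then sup{⟨f, y⟩ : y ∈ ℝ^{ℕ^n_m}, M(y) ⪰ 0, ⟨g, y⟩ = 1} = inf{γ ∈ ℝ : γ·g − f is a sum of squares of forms of degree d}, and the infimum on the right-hand side is attained (strong duality with dual attainment for the SDP relaxation of maximizing f on the unit sphere). -/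
open Finset MvPolynomial

/-- `p` is a sum of squares of forms of degree `d`. -/
def IsSOSdForms (n d : ℕ) (p : MvPolynomial (Fin n) ℝ) : Prop :=
  ∃ (k : ℕ) (q : Fin k → MvPolynomial (Fin n) ℝ),
    (∀ i, (q i).IsHomogeneous d) ∧ p = ∑ i, (q i) ^ 2

namespace S13

noncomputable abbrev ex {n m : ℕ} (α : DegTuple n m) : Fin n →₀ ℕ :=
  Finsupp.equivFunOnFinite.symm α.1

def dadd {n d : ℕ} (α β : DegTuple n d) : DegTuple n (2 * d) :=
  ⟨fun i => α.1 i + β.1 i, by rw [Finset.sum_add_distrib, α.2, β.2, two_mul]⟩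

lemma ex_dadd {n d : ℕ} (α β : DegTuple n d) : ex (dadd α β) = ex α + ex β := by
  ext i; rfl

lemma ex_inj {n m : ℕ} {α β : DegTuple n m} : ex α = ex β ↔ α = β := by
  constructor
  · intro h
    exact Subtype.ext (Finsupp.equivFunOnFinite.symm.injective h)
  · rintro rfl; rfl

lemma ex_degree {n m : ℕ} (α : DegTuple n m) : (ex α).degree = m := by
  rw [Finsupp.degree_eq_sum]; exact α.2

lemma exists_ex {n m : ℕ} (s : Fin n →₀ ℕ) (h : s.degree = m) : ∃ α : DegTuple n m, ex α = s := by
  refine ⟨⟨s, ?_⟩, ?_⟩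
  · rw [← h, Finsupp.degree_eq_sum]
  · ext i; rfl

lemma hom_ext {n m : ℕ} {p q : MvPolynomial (Fin n) ℝ} (hp : p.IsHomogeneous m)
    (hq : q.IsHomogeneous m) (h : ∀ α : DegTuple n m, coeff (ex α) p = coeff (ex α) q) : p = q := by
  ext s
  by_cases hs : s.degree = m
  · obtain ⟨α, rfl⟩ := exists_ex s hs
    exact h α
  · rw [hp.coeff_eq_zero hs, hq.coeff_eq_zero hs]

/-- polynomial with given coefficients -/
noncomputable def poly {n m : ℕ} (c : DegTuple n m → ℝ) : MvPolynomial (Fin n) ℝ :=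
  ∑ α, monomial (ex α) (c α)

lemma poly_hom {n m : ℕ} (c : DegTuple n m → ℝ) : (poly c).IsHomogeneous m := by
  apply IsHomogeneous.sum
  intro α _
  exact isHomogeneous_monomial _ (ex_degree α)

lemma coeff_poly {n m : ℕ} (c : DegTuple n m → ℝ) (α : DegTuple n m) :
    coeff (ex α) (poly c) = c α := by
  classical
  simp only [poly, coeff_sum, coeff_monomial, ex_inj]
  simp

lemma poly_coeff {n m : ℕ} {p : MvPolynomial (Fin n) ℝ} (hp : p.IsHomogeneous m) :
    poly (fun α : DegTuple n m => coeff (ex α) p) = p :=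
  hom_ext (poly_hom _) hp fun α => coeff_poly _ α

noncomputable def co (n m : ℕ) : MvPolynomial (Fin n) ℝ →ₗ[ℝ] (DegTuple n m → ℝ) :=
  LinearMap.pi fun α => lcoeff ℝ (ex α)

lemma co_apply {n m : ℕ} (p : MvPolynomial (Fin n) ℝ) (α : DegTuple n m) :
    co n m p α = coeff (ex α) p := rfl

lemma mpair_eq {n m : ℕ} (p : MvPolynomial (Fin n) ℝ) (y : DegTuple n m → ℝ) :
    mpair p y = ∑ α, co n m p α * y α := rfl

noncomputable def mp {n m : ℕ} (y : DegTuple n m → ℝ) : MvPolynomial (Fin n) ℝ →ₗ[ℝ] ℝ where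
  toFun p := mpair p y
  map_add' p q := by simp [mpair_eq, add_mul, Finset.sum_add_distrib]
  map_smul' a p := by simp [mpair_eq, mul_assoc, Finset.mul_sum]

lemma mp_apply {n m : ℕ} (y : DegTuple n m → ℝ) (p : MvPolynomial (Fin n) ℝ) :
    mp y p = mpair p y := rfl

lemma mp_monomial {n m : ℕ} (y : DegTuple n m → ℝ) (α : DegTuple n m) (r : ℝ) :
    mp y (monomial (ex α) r) = r * y α := by
  classical
  simp only [mp_apply, mpair_eq, co_apply, coeff_monomial, ex_inj]
  simp

/-- Gram polynomial -/
noncomputable def gp {n d : ℕ} (G : Matrix (DegTuple n d) (DegTuple n d) ℝ) :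
    MvPolynomial (Fin n) ℝ := ∑ α, ∑ β, monomial (ex (dadd α β)) (G α β)

lemma gp_smul {n d : ℕ} (a : ℝ) (G : Matrix (DegTuple n d) (DegTuple n d) ℝ) :
    gp (a • G) = a • gp G := by
  simp [gp, Finset.smul_sum, smul_monomial]

lemma gp_add {n d : ℕ} (G H : Matrix (DegTuple n d) (DegTuple n d) ℝ) :
    gp (G + H) = gp G + gp H := by
  simp [gp, Finset.sum_add_distrib]

lemma gp_hom {n d : ℕ} (G : Matrix (DegTuple n d) (DegTuple n d) ℝ) :
    (gp G).IsHomogeneous (2 * d) := by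
  apply IsHomogeneous.sum
  intro α _
  apply IsHomogeneous.sum
  intro β _
  exact isHomogeneous_monomial _ (ex_degree _)

lemma gp_gram {n d : ℕ} (B : Matrix (DegTuple n d) (DegTuple n d) ℝ) :
    gp (B.transpose * B) = ∑ k, (poly (B k)) ^ 2 := by
  simp only [gp, poly, Matrix.mul_apply, Matrix.transpose_apply, map_sum, sq, Finset.sum_mul_sum,
    monomial_mul, ex_dadd]
  conv_lhs => enter [2, x]; rw [Finset.sum_comm]
  rw [Finset.sum_comm]

lemma gp_vec {n d : ℕ} (v : DegTuple n d → ℝ) :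
    gp (Matrix.vecMulVec v v) = (poly v) ^ 2 := by
  simp only [gp, poly, Matrix.vecMulVec_apply, sq, Finset.sum_mul_sum, monomial_mul, ex_dadd]

lemma mp_gp {n d : ℕ} (y : DegTuple n (2 * d) → ℝ) (G : Matrix (DegTuple n d) (DegTuple n d) ℝ) :
    mp y (gp G) = ∑ α, ∑ β, G α β * momMat n d y α β := by
  simp only [gp, map_sum, mp_monomial]; rfl

lemma mp_sq_poly {n d : ℕ} (y : DegTuple n (2 * d) → ℝ) (v : DegTuple n d → ℝ) :
    mp y ((poly v) ^ 2) = star v ⬝ᵥ ((momMat n d y).mulVec v) := by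
  rw [← gp_vec, mp_gp]
  simp only [dotProduct, Matrix.mulVec, Matrix.vecMulVec_apply, Finset.mul_sum]
  refine Finset.sum_congr rfl fun α _ => Finset.sum_congr rfl fun β _ => ?_
  simp; ring

lemma psd_iff {n d : ℕ} (y : DegTuple n (2 * d) → ℝ) :
    (momMat n d y).PosSemidef ↔ ∀ q : MvPolynomial (Fin n) ℝ, q.IsHomogeneous d →
      0 ≤ mp y (q ^ 2) := by
  rw [Matrix.posSemidef_iff_dotProduct_mulVec]
  constructor
  · rintro ⟨_, h⟩ q hq
    rw [← poly_coeff hq, mp_sq_poly]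
    exact h _
  · intro h
    refine ⟨?_, fun v => ?_⟩
    · ext α β
      simp only [Matrix.conjTranspose_apply, momMat, Matrix.of_apply, star_trivial, add_comm]
    · rw [← mp_sq_poly]; exact h _ (poly_hom v)

lemma sos_nonneg {n d : ℕ} {y : DegTuple n (2 * d) → ℝ} (hy : (momMat n d y).PosSemidef)
    {p : MvPolynomial (Fin n) ℝ} (hp : IsSOSdForms n d p) : 0 ≤ mp y p := by
  obtain ⟨k, q, hq, rfl⟩ := hp
  rw [map_sum]
  exact Finset.sum_nonneg fun i _ => (psd_iff y).1 hy _ (hq i)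

lemma sos_smul {n d : ℕ} {p : MvPolynomial (Fin n) ℝ} (hp : IsSOSdForms n d p) {a : ℝ}
    (ha : 0 ≤ a) : IsSOSdForms n d (a • p) := by
  obtain ⟨k, q, hq, rfl⟩ := hp
  refine ⟨k, fun i => C (√a) * q i, fun i => ?_, ?_⟩
  · simpa using (isHomogeneous_C (Fin n) (√a)).mul (hq i)
  · simp only [mul_pow, ← C_pow, Real.sq_sqrt ha, Finset.smul_sum, smul_eq_C_mul]

lemma sos_gram {n d : ℕ} (B : Matrix (DegTuple n d) (DegTuple n d) ℝ) :
    IsSOSdForms n d (gp (B.transpose * B)) := by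
  refine ⟨Fintype.card (DegTuple n d), fun i => poly (B ((Fintype.equivFin _).symm i)),
    fun i => poly_hom _, ?_⟩
  rw [gp_gram]
  exact ((Fintype.equivFin (DegTuple n d)).symm.sum_comp (fun k => (poly (B k)) ^ 2)).symm

lemma gram_ne {n d : ℕ} (B : Matrix (DegTuple n d) (DegTuple n d) ℝ)
    (h : gp (B.transpose * B) = 0) : B = 0 := by
  rw [gp_gram] at h
  have key : ∀ k, poly (B k) = 0 := by
    intro k
    apply MvPolynomial.funext
    intro x
    have h1 := congrArg (eval x) h
    rw [map_sum, map_zero, Finset.sum_eq_zero_iff_of_nonneg] at h1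
    · have := h1 k (mem_univ _)
      simpa using this
    · intro i _; rw [map_pow]; positivity
  ext k α
  rw [← coeff_poly (B k) α, key k]; simp

/-- moments of a point -/
noncomputable def mom {n m : ℕ} (x : Fin n → ℝ) : DegTuple n m → ℝ := fun α => ∏ i, x i ^ α.1 i

lemma mp_mom {n m : ℕ} (x : Fin n → ℝ) {p : MvPolynomial (Fin n) ℝ} (hp : p.IsHomogeneous m) :
    mp (mom (m := m) x) p = eval x p := by
  rw [← poly_coeff hp]
  simp only [poly, map_sum, mp_monomial, eval_monomial]
  refine Finset.sum_congr rfl fun α _ => ?_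
  rw [Finsupp.prod_fintype _ _ (by simp)]; rfl

lemma gform_hom (n d : ℕ) : (gform n d).IsHomogeneous (2 * d) := by
  apply IsHomogeneous.pow
  apply IsHomogeneous.sum
  intro i _
  simpa using (isHomogeneous_X ℝ i).pow 2

lemma split {n : ℕ} (γ : Fin n → ℕ) (k : ℕ) (hk : k ≤ ∑ i, γ i) :
    ∃ α : Fin n → ℕ, (∀ i, α i ≤ γ i) ∧ ∑ i, α i = k := by
  induction k with
  | zero => exact ⟨0, by simp, by simp⟩
  | succ k ih =>
    obtain ⟨α, h1, h2⟩ := ih (by omega)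
    obtain ⟨i, -, hi⟩ : ∃ i ∈ (univ : Finset (Fin n)), α i < γ i :=
      Finset.exists_lt_of_sum_lt (by omega)
    refine ⟨α + Pi.single i 1, fun j => ?_, ?_⟩
    · by_cases hj : j = i
      · subst hj; simp; omega
      · simp [hj, h1 j]
    · simp [Finset.sum_add_distrib, h2]

lemma exists_dadd {n d : ℕ} (γ : DegTuple n (2 * d)) : ∃ α β : DegTuple n d, dadd α β = γ := by
  obtain ⟨α, h1, h2⟩ := split γ.1 d (by rw [γ.2]; omega)
  refine ⟨⟨α, h2⟩, ⟨fun i => γ.1 i - α i, ?_⟩, ?_⟩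
  · have : ∑ i, (γ.1 i - α i) + ∑ i, α i = ∑ i, γ.1 i := by
      rw [← Finset.sum_add_distrib]
      exact Finset.sum_congr rfl fun i _ => Nat.sub_add_cancel (h1 i)
    rw [γ.2, h2] at this; show ∑ i, (γ.1 i - α i) = d; omega
  · apply Subtype.ext; funext i; exact Nat.add_sub_cancel' (h1 i)

lemma diag_nonneg {n d : ℕ} {y : DegTuple n (2 * d) → ℝ} (hy : (momMat n d y).PosSemidef)
    (α : DegTuple n d) : 0 ≤ y (dadd α α) := hy.diag_nonneg (i := α)

lemma gform_expand (n d : ℕ) : gform n d = ∑ α : DegTuple n d,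
    (Nat.multinomial univ α.1 : ℝ) • monomial (ex (dadd α α)) 1 := by
  rw [gform, Finset.sum_pow_eq_sum_piAntidiag]
  symm
  refine Finset.sum_bij (fun α _ => α.1) ?_ ?_ ?_ ?_
  · intro α _; simp [α.2]
  · intro α _ β _ h; exact Subtype.ext h
  · intro k hk; exact ⟨⟨k, by simpa using hk⟩, mem_univ _, rfl⟩
  · intro α _
    rw [smul_eq_C_mul]
    rw [map_natCast]
    congr 1
    · rw [monomial_eq, Finsupp.prod_fintype _ _ (by simp)]
      simp only [C_1, one_mul]
      refine Finset.prod_congr rfl fun i _ => ?_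
      rw [← pow_mul, two_mul (α.1 i)]; rfl

lemma diag_le {n d : ℕ} {y : DegTuple n (2 * d) → ℝ} (hy : (momMat n d y).PosSemidef)
    (α : DegTuple n d) : y (dadd α α) ≤ mp y (gform n d) := by
  rw [gform_expand, map_sum]
  simp only [map_smul, mp_monomial, smul_eq_mul, one_mul]
  refine le_trans ?_ (Finset.single_le_sum (f := fun α : DegTuple n d =>
    (Nat.multinomial univ α.1 : ℝ) * y (dadd α α)) (fun β _ =>
      mul_nonneg (by positivity) (diag_nonneg hy β)) (mem_univ α))
  have : (1 : ℝ) ≤ (Nat.multinomial univ α.1 : ℝ) := by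
    exact_mod_cast Nat.multinomial_pos _ _
  nlinarith [diag_nonneg hy α]

lemma abs_le {n d : ℕ} {y : DegTuple n (2 * d) → ℝ} (hy : (momMat n d y).PosSemidef)
    (γ : DegTuple n (2 * d)) : |y γ| ≤ mp y (gform n d) := by
  obtain ⟨α, β, rfl⟩ := exists_dadd γ
  have hα := diag_le hy α
  have hβ := diag_le hy β
  have hm : ∀ α : DegTuple n d, (monomial (ex α) (1 : ℝ)).IsHomogeneous d :=
    fun α => isHomogeneous_monomial _ (ex_degree α)
  have h1 := (psd_iff y).1 hy _ ((hm α).add (hm β))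
  have h2 := (psd_iff y).1 hy _ ((hm α).sub (hm β))
  have hmm : ∀ α β : DegTuple n d, monomial (ex (dadd α β)) (1 : ℝ) =
      monomial (ex α) 1 * monomial (ex β) 1 := by
    intro α β; rw [monomial_mul, ex_dadd, one_mul]
  have e1 : (monomial (ex α) (1 : ℝ) + monomial (ex β) 1) ^ 2 = monomial (ex (dadd α α)) 1
     + (2 : ℝ) • monomial (ex (dadd α β)) 1 + monomial (ex (dadd β β)) 1 := by
    rw [hmm, hmm, hmm, smul_eq_C_mul, map_ofNat]; ring
  have e2 : (monomial (ex α) (1 : ℝ) - monomial (ex β) 1) ^ 2 = monomial (ex (dadd α α)) 1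
     - (2 : ℝ) • monomial (ex (dadd α β)) 1 + monomial (ex (dadd β β)) 1 := by
    rw [hmm, hmm, hmm, smul_eq_C_mul, map_ofNat]; ring
  rw [e1] at h1
  rw [e2] at h2
  simp only [map_add, map_sub, map_smul, mp_monomial, smul_eq_mul, one_mul] at h1 h2
  rw [_root_.abs_le]
  constructor <;> linarith

/-- PSD matrices with unit trace -/
def P1 (n d : ℕ) : Set (Matrix (DegTuple n d) (DegTuple n d) ℝ) :=
  {G | G.PosSemidef ∧ G.trace = 1}

lemma P1_convex (n d : ℕ) : Convex ℝ (P1 n d) := by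
  rintro G ⟨hG, tG⟩ H ⟨hH, tH⟩ a b ha hb hab
  refine ⟨(hG.smul ha).add (hH.smul hb), ?_⟩
  simp [tG, tH, hab]

lemma P1_eq (n d : ℕ) : P1 n d = (fun B : Matrix (DegTuple n d) (DegTuple n d) ℝ =>
    B.transpose * B) '' {B | ∑ i, ∑ j, B i j ^ 2 = 1} := by
  have tr : ∀ B : Matrix (DegTuple n d) (DegTuple n d) ℝ,
      (B.transpose * B).trace = ∑ i, ∑ j, B i j ^ 2 := by
    intro B
    simp only [Matrix.trace, Matrix.diag_apply, Matrix.mul_apply, Matrix.transpose_apply, sq]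
    rw [Finset.sum_comm]
  ext G
  constructor
  · rintro ⟨hG, tG⟩
    obtain ⟨B, hB⟩ : ∃ B : Matrix (DegTuple n d) (DegTuple n d) ℝ, G = B.conjTranspose * B := by
      open scoped MatrixOrder Matrix.Norms.L2Operator in
      exact CStarAlgebra.nonneg_iff_eq_star_mul_self.mp hG.nonneg
    rw [Matrix.conjTranspose_eq_transpose_of_trivial] at hB
    exact ⟨B, by rw [Set.mem_ofPred_eq, ← tr, ← hB, tG], hB.symm⟩
  · rintro ⟨B, hB, rfl⟩
    refine ⟨?_, by rw [tr]; exact hB⟩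
    have := Matrix.posSemidef_conjTranspose_mul_self B
    rwa [Matrix.conjTranspose_eq_transpose_of_trivial] at this

lemma sphere_compact (ι : Type) [Fintype ι] :
    IsCompact {B : Matrix ι ι ℝ | ∑ i, ∑ j, B i j ^ 2 = 1} := by
  have hI : IsCompact (Set.Icc (fun _ _ => -1 : ι → ι → ℝ) (fun _ _ => 1)) := isCompact_Icc
  refine IsCompact.of_isClosed_subset (s := (Set.Icc (fun _ _ => -1 : ι → ι → ℝ) (fun _ _ => 1))) hI ?_ ?_
  · refine isClosed_eq ?_ continuous_const
    fun_prop
  · intro B hB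
    have : ∀ i j, B i j ^ 2 ≤ 1 := by
      intro i j
      rw [← (show ∑ i, ∑ j, B i j ^ 2 = 1 from hB)]
      refine le_trans (Finset.single_le_sum (f := fun j => B i j ^ 2)
        (fun _ _ => sq_nonneg _) (mem_univ j)) ?_
      exact Finset.single_le_sum (f := fun i => ∑ j, B i j ^ 2)
        (fun _ _ => Finset.sum_nonneg fun _ _ => sq_nonneg _) (mem_univ i)
    constructor
    · intro i j; have := this i j; show -1 ≤ B i j; nlinarith
    · intro i j; have := this i j; show B i j ≤ 1; nlinarith

lemma P1_compact (n d : ℕ) : IsCompact (P1 n d) := by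
  rw [P1_eq]
  refine (sphere_compact _).image ?_
  fun_prop

noncomputable def A (n d : ℕ) :
    Matrix (DegTuple n d) (DegTuple n d) ℝ →ₗ[ℝ] (DegTuple n (2 * d) → ℝ) where
  toFun G := co n (2 * d) (gp G)
  map_add' G H := by rw [gp_add, map_add]
  map_smul' a G := by rw [gp_smul, map_smul]; rfl

lemma A_apply {n d : ℕ} (G : Matrix (DegTuple n d) (DegTuple n d) ℝ) :
    A n d G = co n (2 * d) (gp G) := rfl

lemma A_cont (n d : ℕ) : Continuous (A n d) := LinearMap.continuous_of_finiteDimensional _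

/-- positivity on P1 gives a PSD moment matrix -/
lemma psd_of_P1 {n d : ℕ} (y : DegTuple n (2 * d) → ℝ) (h : ∀ G ∈ P1 n d, 0 ≤ mp y (gp G)) :
    (momMat n d y).PosSemidef := by
  rw [psd_iff]
  intro q hq
  rw [← poly_coeff hq, ← gp_vec]
  set v : DegTuple n d → ℝ := fun α => coeff (ex α) q
  have hps : (Matrix.vecMulVec v v).PosSemidef := by
    simpa using Matrix.posSemidef_vecMulVec_self_star v
  have htr : (Matrix.vecMulVec v v).trace = ∑ i, v i ^ 2 := by
    simp [Matrix.trace, Matrix.vecMulVec_apply, sq]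
  have h0 : 0 ≤ ∑ i, v i ^ 2 := Finset.sum_nonneg fun i _ => sq_nonneg _
  rcases h0.eq_or_lt with h0 | h0
  · have : v = 0 := by
      have := (Finset.sum_eq_zero_iff_of_nonneg (fun i _ => sq_nonneg (v i))).1 h0.symm
      funext i
      simpa using this i (mem_univ i)
    rw [this]
    simp [gp]
  · have := h ((∑ i, v i ^ 2)⁻¹ • Matrix.vecMulVec v v)
      ⟨hps.smul (by positivity), by rw [Matrix.trace_smul, htr, smul_eq_mul, inv_mul_cancel₀ h0.ne']⟩
    rw [gp_smul, map_smul, smul_eq_mul] at this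
    exact (mul_nonneg_iff_of_pos_left (by positivity)).1 this

/-- bipolar: closedness of the SOS cone -/
lemma sos_of_nonneg {n d : ℕ} {p : MvPolynomial (Fin n) ℝ} (hp : p.IsHomogeneous (2 * d))
    (h : ∀ y : DegTuple n (2 * d) → ℝ, (momMat n d y).PosSemidef → 0 ≤ mp y p) :
    IsSOSdForms n d p := by
  by_contra hns
  have hp0 : p ≠ 0 := by
    rintro rfl
    exact hns ⟨0, fun _ => 0, fun i => i.elim0, by simp⟩
  set w := co n (2 * d) p with hw
  have hdisj : Disjoint ((fun t : ℝ => t • w) '' Set.Ici 0) (A n d '' P1 n d) := by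
    rw [Set.disjoint_left]
    rintro _ ⟨t, ht, rfl⟩ ⟨G, hG, hGt⟩
    have hG' := hG
    rw [P1_eq] at hG'
    obtain ⟨B, hB, rfl⟩ := hG'
    have heq : gp (B.transpose * B) = t • p := by
      refine hom_ext (gp_hom _) ?_ fun α => ?_
      · rw [smul_eq_C_mul]; simpa using (isHomogeneous_C (Fin n) t).mul hp
      · have := congrFun hGt α
        simpa [A_apply, hw, co_apply] using this
    rcases (show (0 : ℝ) ≤ t from ht).eq_or_lt with h0 | h0
    · rw [← h0, zero_smul] at heq
      have := gram_ne B heq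
      subst this
      simp at hB
    · apply hns
      have := sos_smul (sos_gram B) (a := t⁻¹) (by positivity)
      rwa [heq, smul_smul, inv_mul_cancel₀ h0.ne', one_smul] at this
  obtain ⟨l, u, v, h1, huv, h2⟩ := geometric_hahn_banach_closed_compact
    ((convex_Ici (0 : ℝ)).is_linear_image (f := fun t : ℝ => t • w)
      ⟨fun a b => add_smul a b w, fun a b => by simp [mul_smul]⟩)
    (isClosedMap_smul_left w _ isClosed_Ici)
    ((P1_convex n d).linear_image (A n d)) ((P1_compact n d).image (A_cont n d)) hdisj
  have hu : 0 < u := by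
    simpa using h1 0 ⟨0, by simp, by simp⟩
  have hlw : l w ≤ 0 := by
    by_contra! hc
    have := h1 ((u / l w) • w) ⟨u / l w, by simp; positivity, rfl⟩
    rw [map_smul, smul_eq_mul, div_mul_cancel₀ _ hc.ne'] at this
    exact lt_irrefl _ this
  set y : DegTuple n (2 * d) → ℝ := fun γ => l (Pi.single γ 1) with hy
  have hly : ∀ q, mp y q = l (co n (2 * d) q) := by
    intro q
    conv_rhs => rw [← Finset.univ_sum_single (co n (2 * d) q)]
    rw [map_sum, mp_apply, mpair_eq]
    refine Finset.sum_congr rfl fun γ _ => ?_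
    have : (Pi.single γ (co n (2 * d) q γ) : DegTuple n (2 * d) → ℝ) =
        (co n (2 * d) q γ) • Pi.single γ 1 := by
      rw [← Pi.single_smul]; simp
    rw [this, map_smul, smul_eq_mul]
  obtain ⟨K, hK⟩ := (P1_compact n d).exists_bound_of_continuousOn
    (f := fun G => ∑ γ, A n d G γ * w γ) (by
      have := A_cont n d
      fun_prop)
  have hmain : ∀ ε : ℝ, ∀ q, mp (y - ε • w) q = mp y q - ε * ∑ γ, co n (2 * d) q γ * w γ := by
    intro ε q
    simp only [mp_apply, mpair_eq, Pi.sub_apply, Pi.smul_apply, smul_eq_mul, mul_sub,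
      Finset.sum_sub_distrib, Finset.mul_sum]
    congr 1
    exact Finset.sum_congr rfl fun _ _ => by ring
  have hε : 0 < u / (|K| + 1) := by positivity
  have h3 := h (y - (u / (|K| + 1)) • w) (by
    apply psd_of_P1
    intro G hG
    rw [hmain, hly]
    have a1 := h2 _ ⟨G, hG, rfl⟩
    have a2 := hK G hG
    rw [Real.norm_eq_abs] at a2
    rw [A_apply] at a1
    simp only [A_apply] at a2
    have a3 := (le_abs_self _).trans (a2.trans (le_abs_self K))
    have a4 := mul_le_mul_of_nonneg_left a3 hε.le
    have a5 : u / (|K| + 1) * |K| ≤ u := by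
      rw [div_mul_eq_mul_div, div_le_iff₀ (by positivity)]
      nlinarith
    linarith)
  rw [hmain, hly, ← hw] at h3
  have hpos : 0 < ∑ γ, w γ * w γ := by
    obtain ⟨γ, hγ⟩ : ∃ γ, w γ ≠ 0 := by
      by_contra! hc
      exact hp0 (hom_ext hp (isHomogeneous_zero _ _ _) fun α => (hc α).trans (coeff_zero _).symm)
    exact Finset.sum_pos' (fun _ _ => mul_self_nonneg _) ⟨γ, mem_univ _, mul_self_pos.2 hγ⟩
  nlinarith [mul_pos hε hpos]

end S13

open S13 in
theorem stmt_13 (n d : ℕ) (hn : 2 ≤ n) (hd : 1 ≤ d)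
    (f : MvPolynomial (Fin n) ℝ) (hf : f.IsHomogeneous (2 * d)) :
    ∃ γ : ℝ,
      IsLeast {γ' : ℝ | IsSOSdForms n d (γ' • gform n d - f)} γ ∧
      sSup {r : ℝ | ∃ y : DegTuple n (2 * d) → ℝ,
        (momMat n d y).PosSemidef ∧ mpair (gform n d) y = 1 ∧ mpair f y = r} = γ := by
  set S := {r : ℝ | ∃ y : DegTuple n (2 * d) → ℝ,
        (momMat n d y).PosSemidef ∧ mpair (gform n d) y = 1 ∧ mpair f y = r} with hS
  have hne : S.Nonempty := by
    let x : Fin n → ℝ := Pi.single ⟨0, by omega⟩ 1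
    refine ⟨_, mom x, ?_, ?_, rfl⟩
    · rw [psd_iff]
      intro q hq
      rw [mp_mom x (by simpa [mul_comm] using hq.pow 2), map_pow]
      positivity
    · rw [← mp_apply, mp_mom x (gform_hom n d)]
      have : ∑ i, x i ^ 2 = 1 := by
        rw [Finset.sum_eq_single ⟨0, by omega⟩]
        · simp [x]
        · intro b _ hb; simp [x, hb]
        · simp
      simp [gform, this]
  have hbdd : BddAbove S := by
    refine ⟨∑ α : DegTuple n (2 * d), |co n (2 * d) f α|, ?_⟩
    rintro _ ⟨y, hy, hg, rfl⟩
    rw [mpair_eq]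
    refine Finset.sum_le_sum fun α _ => ?_
    have h1 := S13.abs_le hy α
    rw [mp_apply, hg] at h1
    calc _ ≤ |co n (2 * d) f α * y α| := le_abs_self _
      _ = |co n (2 * d) f α| * |y α| := abs_mul _ _
      _ ≤ |co n (2 * d) f α| * 1 := mul_le_mul_of_nonneg_left h1 (abs_nonneg _)
      _ = _ := mul_one _
  refine ⟨sSup S, ⟨?_, ?_⟩, rfl⟩
  · refine sos_of_nonneg ?_ ?_
    · refine IsHomogeneous.sub ?_ hf
      rw [smul_eq_C_mul]; simpa using (isHomogeneous_C (Fin n) (sSup S)).mul (gform_hom n d)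
    · intro y hy
      rw [map_sub, map_smul, smul_eq_mul]
      have hg0 : 0 ≤ mp y (gform n d) := by
        have α : DegTuple n (2 * d) := ⟨Pi.single ⟨0, by omega⟩ (2 * d), by simp⟩
        exact (abs_nonneg _).trans (S13.abs_le hy α)
      rcases hg0.eq_or_lt with h0 | h0
      · have : y = 0 := by
          funext α
          have := S13.abs_le hy α
          rw [← h0] at this
          simpa using this
        rw [← h0, this]
        simp [mp_apply, mpair_eq]
      · have hsc : ∀ p, mpair p ((mp y (gform n d))⁻¹ • y) = (mp y (gform n d))⁻¹ * mp y p := by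
          intro p
          simp only [mp_apply, mpair_eq, Pi.smul_apply, smul_eq_mul, Finset.mul_sum]
          exact Finset.sum_congr rfl fun _ _ => by ring
        have hmem : (mp y (gform n d))⁻¹ * mp y f ∈ S := by
          refine ⟨(mp y (gform n d))⁻¹ • y, ?_, ?_, hsc f⟩
          · rw [psd_iff]
            intro q hq
            rw [mp_apply, hsc]
            exact mul_nonneg (by positivity) ((psd_iff y).1 hy q hq)
          · rw [hsc, inv_mul_cancel₀ h0.ne']
        have := le_csSup hbdd hmem
        rw [inv_mul_le_iff₀ h0] at this
        linarith
  · intro γ' hγ'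
    refine csSup_le hne ?_
    rintro _ ⟨y, hy, hg, rfl⟩
    have := sos_nonneg hy hγ'
    rw [map_sub, map_smul, smul_eq_mul, mp_apply, mp_apply, hg] at this
    linarith
end

section
/- Let n ≥ 2, d ≥ 1, m = 2d, f a form of degree m in n variables, g = (x₁²+⋯+x_n²)^d, and f_max = max_{‖x‖=1} f(x). Let y* be a maximizer of ⟨f, y⟩ over the feasible set {y ∈ ℝ^{ℕ^n_m} : M(y) ⪰ 0, ⟨g, y⟩ = 1}, and suppose ⟨f, y*⟩ = f_max (i.e., the SDP relaxation is tight). Suppose moreover that σ := f_max·g − f is a smooth point of the boundary of Σ_{n,m} in the following sense: there exists a nonzero linear functional ℓ on the space of degree-m forms with ℓ ≥ 0 on Σ_{n,m} and ℓ(σ) = 0, and any two such functionals are positive scalar multiples of each other. Then rank M(y*) = 1. -/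
open Finset MvPolynomial

theorem homog_expand {n m : ℕ} (p : MvPolynomial (Fin n) ℝ) (hp : p.IsHomogeneous m) :
    p = ∑ α : DegTuple n m, monomial (Finsupp.equivFunOnFinite.symm α.1)
      (coeff (Finsupp.equivFunOnFinite.symm α.1) p) := by
  ext s
  rw [coeff_sum]
  simp only [coeff_monomial]
  by_cases hs : ∑ i, s i = m
  · symm
    refine (Finset.sum_eq_single (⟨s, hs⟩ : DegTuple n m) ?_ ?_).trans ?_
    rotate_left 2
    · have : Finsupp.equivFunOnFinite.symm (s : Fin n → ℕ) = s := by ext; simp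
      simp [this]
    · intro b _ hb
      rw [if_neg]
      intro h
      apply hb
      apply Subtype.ext
      exact congrArg (fun t : Fin n →₀ ℕ => (t : Fin n → ℕ)) h
    · intro h
      exact absurd (Finset.mem_univ (α := DegTuple n m) _) h
  · symm
    refine (Finset.sum_eq_zero ?_).trans ?_
    rotate_left
    · symm
      apply hp.coeff_eq_zero
      rwa [Finsupp.degree_eq_sum]
    · intro b _
      rw [if_neg]
      intro h
      apply hs
      rw [← h]
      exact b.2

theorem mpair_sub' {n m : ℕ} (p q : MvPolynomial (Fin n) ℝ) (y : DegTuple n m → ℝ) :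
    mpair (p - q) y = mpair p y - mpair q y := by
  simp [mpair, sub_mul, Finset.sum_sub_distrib]

theorem mpair_smul' {n m : ℕ} (c : ℝ) (p : MvPolynomial (Fin n) ℝ) (y : DegTuple n m → ℝ) :
    mpair (c • p) y = c * mpair p y := by
  simp [mpair, mul_assoc, Finset.mul_sum]

theorem mpair_smul_right' {n m : ℕ} (c : ℝ) (p : MvPolynomial (Fin n) ℝ)
    (y : DegTuple n m → ℝ) :
    mpair p (c • y) = c * mpair p y := by
  simp only [mpair, Finset.mul_sum, Pi.smul_apply, smul_eq_mul]
  exact Finset.sum_congr rfl fun _ _ => by ring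

theorem mpair_sum' {n m : ℕ} {ι : Type} (s : Finset ι) (p : ι → MvPolynomial (Fin n) ℝ)
    (y : DegTuple n m → ℝ) :
    mpair (∑ i ∈ s, p i) y = ∑ i ∈ s, mpair (p i) y := by
  simp only [mpair, coeff_sum, Finset.sum_mul]
  exact Finset.sum_comm

theorem mpair_monomial' {n m : ℕ} (α : DegTuple n m) (c : ℝ) (y : DegTuple n m → ℝ) :
    mpair (monomial (Finsupp.equivFunOnFinite.symm α.1) c) y = c * y α := by
  unfold mpair
  rw [Finset.sum_eq_single α]
  · simp
  · intro b _ hb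
    rw [coeff_monomial, if_neg, zero_mul]
    intro h
    exact hb (Subtype.ext (Finsupp.equivFunOnFinite.symm.injective h)).symm
  · simp

theorem mpair_sq {n d : ℕ} (q : MvPolynomial (Fin n) ℝ) (hq : q.IsHomogeneous d)
    (y : DegTuple n (2 * d) → ℝ) :
    mpair (q ^ 2) y = ∑ α : DegTuple n d, ∑ β : DegTuple n d,
      coeff (Finsupp.equivFunOnFinite.symm α.1) q *
        (momMat n d y α β * coeff (Finsupp.equivFunOnFinite.symm β.1) q) := by
  conv_lhs => rw [homog_expand q hq, sq, Finset.sum_mul_sum, mpair_sum']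
  refine Finset.sum_congr rfl fun α _ => ?_
  rw [mpair_sum']
  refine Finset.sum_congr rfl fun β _ => ?_
  rw [monomial_mul]
  have h := mpair_monomial' (⟨fun i => α.1 i + β.1 i, by
    rw [Finset.sum_add_distrib, α.2, β.2, two_mul]⟩ : DegTuple n (2 * d))
    (coeff (Finsupp.equivFunOnFinite.symm α.1) q * coeff (Finsupp.equivFunOnFinite.symm β.1) q) y
  have e : Finsupp.equivFunOnFinite.symm α.1 + Finsupp.equivFunOnFinite.symm β.1
    = Finsupp.equivFunOnFinite.symm (fun i => α.1 i + β.1 i) := by ext; simp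
  rw [e, h]
  simp only [momMat, Matrix.of_apply]
  ring

theorem mpair_sos {n d : ℕ} (y : DegTuple n (2 * d) → ℝ) (hy : (momMat n d y).PosSemidef)
    (p : MvPolynomial (Fin n) ℝ) (hp : IsSOSdForms n d p) : 0 ≤ mpair p y := by
  obtain ⟨k, q, hq, rfl⟩ := hp
  rw [mpair_sum']
  refine Finset.sum_nonneg fun i _ => ?_
  rw [mpair_sq _ (hq i)]
  have h := hy.dotProduct_mulVec_nonneg
    (fun α : DegTuple n d => coeff (Finsupp.equivFunOnFinite.symm α.1) (q i))
  simpa [dotProduct, Matrix.mulVec, Finset.mul_sum] using h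

/-- evaluation functional as a moment vector -/
def evVec {n : ℕ} (m : ℕ) (x : Fin n → ℝ) : DegTuple n m → ℝ := fun α => ∏ i, x i ^ α.1 i

theorem mpair_evVec {n m : ℕ} (p : MvPolynomial (Fin n) ℝ) (hp : p.IsHomogeneous m)
    (x : Fin n → ℝ) : mpair p (evVec m x) = eval x p := by
  conv_rhs => rw [homog_expand p hp]
  simp only [mpair, evVec, map_sum, eval_monomial]
  refine Finset.sum_congr rfl fun α _ => ?_
  rw [Finsupp.prod_fintype _ _ (by simp)]
  simp

theorem momMat_evVec {n d : ℕ} (x : Fin n → ℝ) :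
    momMat n d (evVec (2 * d) x) = Matrix.vecMulVec (evVec d x) (evVec d x) := by
  ext α β
  simp [momMat, evVec, Matrix.vecMulVec_apply, pow_add, Finset.prod_mul_distrib]

theorem gform_homog (n d : ℕ) : (gform n d).IsHomogeneous (2 * d) := by
  unfold gform
  exact (IsHomogeneous.sum _ _ _ fun i _ => by
    simpa using (isHomogeneous_X ℝ i).pow 2).pow d

theorem stmt_14 (n d : ℕ) (hn : 2 ≤ n) (hd : 1 ≤ d)
    (f : MvPolynomial (Fin n) ℝ) (hf : f.IsHomogeneous (2 * d))
    (fmax : ℝ)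
    (hfmax : IsGreatest {r : ℝ | ∃ x : Fin n → ℝ, ∑ i, (x i) ^ 2 = 1 ∧
      MvPolynomial.eval x f = r} fmax)
    (ystar : DegTuple n (2 * d) → ℝ)
    (hpsd : (momMat n d ystar).PosSemidef)
    (hfeas : mpair (gform n d) ystar = 1)
    (hopt : ∀ y : DegTuple n (2 * d) → ℝ, (momMat n d y).PosSemidef →
      mpair (gform n d) y = 1 → mpair f y ≤ mpair f ystar)
    (htight : mpair f ystar = fmax)
    (hsmooth : ∃ z : DegTuple n (2 * d) → ℝ, z ≠ 0 ∧
      (∀ p : MvPolynomial (Fin n) ℝ, IsSOSdForms n d p → 0 ≤ mpair p z) ∧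
      mpair (fmax • gform n d - f) z = 0 ∧
      (∀ z' : DegTuple n (2 * d) → ℝ, z' ≠ 0 →
        (∀ p : MvPolynomial (Fin n) ℝ, IsSOSdForms n d p → 0 ≤ mpair p z') →
        mpair (fmax • gform n d - f) z' = 0 →
        ∃ c : ℝ, 0 < c ∧ z' = c • z)) :
    (momMat n d ystar).rank = 1 := by
  obtain ⟨⟨x, hx, hfx⟩, -⟩ := hfmax
  obtain ⟨z, -, -, -, huniq⟩ := hsmooth
  have hgx : mpair (gform n d) (evVec (2 * d) x) = 1 := by
    rw [mpair_evVec _ (gform_homog n d)]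
    simp [gform, hx]
  have hne : ∀ y : DegTuple n (2 * d) → ℝ, mpair (gform n d) y = 1 → y ≠ 0 := by
    rintro y hy rfl
    simp [mpair] at hy
  have hpx : (momMat n d (evVec (2 * d) x)).PosSemidef := by
    rw [momMat_evVec]
    simpa using Matrix.posSemidef_vecMulVec_self_star (evVec d x)
  obtain ⟨a, ha, hya⟩ := huniq ystar (hne _ hfeas) (mpair_sos _ hpsd) (by
    rw [mpair_sub', mpair_smul', hfeas, htight]; ring)
  obtain ⟨b, hb, hxb⟩ := huniq _ (hne _ hgx) (mpair_sos _ hpx) (by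
    rw [mpair_sub', mpair_smul', hgx, mpair_evVec _ hf, hfx]; ring)
  have hab : a = b := by
    have h1 := hfeas
    have h2 := hgx
    rw [hya, mpair_smul_right'] at h1
    rw [hxb, mpair_smul_right'] at h2
    have h0 : mpair (gform n d) z ≠ 0 := by
      intro h; simp [h] at h1
    exact mul_right_cancel₀ h0 (h1.trans h2.symm)
  have hy : ystar = evVec (2 * d) x := by rw [hya, hxb, hab]
  have hM := momMat_evVec (d := d) x
  rw [hy, hM]
  apply le_antisymm (Matrix.rank_vecMulVec_le _ _)
  rw [Nat.one_le_iff_ne_zero, Ne]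
  intro hr
  have h0 : Matrix.vecMulVec (evVec d x) (evVec d x) = 0 := by
    rw [Matrix.rank, Submodule.finrank_eq_zero, LinearMap.range_eq_bot] at hr
    apply Matrix.ext_of_mulVec_single
    intro i
    rw [Matrix.zero_mulVec]
    exact congrArg (fun L => L (Pi.single i (1 : ℝ))) hr
  rw [← hM] at h0
  apply hne _ hgx
  have hv : ∀ α : DegTuple n d, evVec d x α = 0 := by
    intro α
    have := congrFun (congrFun (hM.symm.trans h0) α) α
    simpa [Matrix.vecMulVec_apply] using this
  -- some coordinate of x is nonzero
  exfalso
  have hx0 : ∀ i, x i = 0 := by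
    intro i
    have := hv ⟨Pi.single i d, by simp⟩
    have h2 : x i ^ d = 0 := by
      rw [← this]
      simp only [evVec]
      rw [Finset.prod_eq_single i]
      · simp
      · intro j _ hj; simp [hj]
      · simp
    exact eq_zero_of_pow_eq_zero h2
  simp [hx0] at hx
end

section
/- Let m' ≥ 1 and n₁,…,n_{m'} be positive integers, and let I = {1,…,n₁}×⋯×{1,…,n_{m'}}. Let W be a real positive semidefinite matrix with rows and columns indexed by I which is coordinatewise swap-invariant: for every ı, ȷ ∈ I and every k ∈ {1,…,m'}, W_{ı,ȷ} = W_{ı', ȷ'} where ı' agrees with ı except ı'_k = ȷ_k and ȷ' agrees with ȷ except ȷ'_k = ı_k. If rank W = 1 and Trace W = 1, then there exist unit vectors v^k ∈ ℝ^{n_k} (k = 1,…,m') such that W_{ı,ȷ} = Π_{k=1}^{m'} (v^k)_{ı_k}(v^k)_{ȷ_k} for all ı, ȷ ∈ I; i.e., W = (v¹(v¹)ᵀ)⊗⋯⊗(v^{m'}(v^{m'})ᵀ). -/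
open Finset

/-- A positive semidefinite matrix `W` indexed by `I = [n₁]×⋯×[n_{m'}]` which is
coordinatewise swap-invariant and has `rank W = 1` and `Trace W = 1` is the Kronecker
product `(v¹(v¹)ᵀ)⊗⋯⊗(v^{m'}(v^{m'})ᵀ)` of rank-1 projections onto unit vectors:
`W_{ı,ȷ} = ∏_k (v^k)_{ı_k} (v^k)_{ȷ_k}`. -/
theorem stmt_17 (m' : ℕ) (hm' : 1 ≤ m') (n : Fin m' → ℕ)
    (W : Matrix (∀ k, Fin (n k)) (∀ k, Fin (n k)) ℝ)
    (hpsd : W.PosSemidef)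
    (hswap : ∀ (i j : ∀ k, Fin (n k)) (k : Fin m'),
      W i j = W (Function.update i k (j k)) (Function.update j k (i k)))
    (hrank : W.rank = 1) (htr : W.trace = 1) :
    ∃ v : ∀ k, Fin (n k) → ℝ,
      (∀ k, ∑ s, (v k s) ^ 2 = 1) ∧
      ∀ i j, W i j = ∏ k, v k (i k) * v k (j k) := by
  have hx : ∃ (x c : (∀ k, Fin (n k)) → ℝ), ∀ i j, W i j = x i * c j := by
    rw [Matrix.rank_eq_finrank_span_cols] at hrank
    obtain ⟨x, _, hx⟩ := finrank_eq_one_iff'.1 hrank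
    have h : ∀ j, ∃ c : ℝ, ∀ i, W i j = x.1 i * c := by
      intro j
      obtain ⟨c, hc⟩ := hx ⟨W.col j, Submodule.subset_span ⟨j, rfl⟩⟩
      refine ⟨c, fun i => ?_⟩
      have h2 := congrFun (congrArg Subtype.val hc) i
      have h3 : c * x.1 i = W i j := h2
      rw [← h3, mul_comm]
    choose c hc using h
    exact ⟨x.1, c, fun i j => hc j i⟩
  obtain ⟨x, c, hxc⟩ := hx
  have hsym : ∀ i j, W i j = W j i := by
    intro i j
    have h := hpsd.1.apply i j
    simpa using h.symm
  have ha : ∃ a, 0 < W a a := by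
    by_contra! h
    have : W.trace ≤ 0 := Finset.sum_nonpos fun i _ => h i
    linarith
  obtain ⟨a, ha⟩ := ha
  obtain ⟨w, hw⟩ : ∃ w : (∀ k, Fin (n k)) → ℝ, ∀ i j, W i j = w i * w j := by
    refine ⟨fun i => W i a / √(W a a), fun i j => ?_⟩
    have h1 : W i a / √(W a a) * (W j a / √(W a a)) = W i a * W j a / W a a := by
      rw [div_mul_div_comm, Real.mul_self_sqrt ha.le]
    simp only
    rw [h1, eq_div_iff ha.ne', hsym j a, hxc, hxc, hxc, hxc]
    ring
  have hwa : w a ≠ 0 := by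
    intro h
    rw [hw, h] at ha
    simp at ha
  set u : ∀ k, Fin (n k) → ℝ := fun k s => w (Function.update a k s) / w a with hu
  have hua : ∀ k, u k (a k) = 1 := by
    intro k
    simp [hu, hwa]
  have hstep : ∀ i k, w i = w (Function.update i k (a k)) * u k (i k) := by
    intro i k
    have h := hswap i a k
    rw [hw, hw] at h
    simp only [hu]
    rw [mul_div_assoc', eq_div_iff hwa, h]
  have hprod : ∀ (i : ∀ k, Fin (n k)) (S : Finset (Fin m')),
      w i = w (S.piecewise a i) * ∏ k ∈ S, u k (i k) := by
    intro i S
    induction S using Finset.induction_on with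
    | empty => simp
    | insert k S hk ih =>
      rw [ih, Finset.prod_insert hk, hstep (S.piecewise a i) k, Finset.piecewise_insert,
        Finset.piecewise_eq_of_notMem _ _ _ hk]
      ring
  have hfull : ∀ i, w i = w a * ∏ k, u k (i k) := by
    intro i
    have h := hprod i Finset.univ
    simpa using h
  have hpos : ∀ k, 0 < ∑ s, (u k s) ^ 2 := by
    intro k
    refine Finset.sum_pos' (fun s _ => sq_nonneg _) ⟨a k, Finset.mem_univ _, ?_⟩
    rw [hua]; norm_num
  have hone : (w a) ^ 2 * ∏ k, ∑ s, (u k s) ^ 2 = 1 := by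
    rw [Finset.prod_univ_sum, Fintype.piFinset_univ, Finset.mul_sum, ← htr, Matrix.trace]
    refine Finset.sum_congr rfl fun i _ => ?_
    rw [Matrix.diag_apply, hw, hfull i, Finset.prod_pow]
    ring
  refine ⟨fun k s => u k s / √(∑ t, (u k t) ^ 2), fun k => ?_, fun i j => ?_⟩
  · simp only [div_pow, Real.sq_sqrt (hpos k).le]
    rw [← Finset.sum_div, div_self (hpos k).ne']
  · have h1 : ∀ k, u k (i k) / √(∑ t, (u k t) ^ 2) * (u k (j k) / √(∑ t, (u k t) ^ 2))
        = u k (i k) * u k (j k) / ∑ t, (u k t) ^ 2 := by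
      intro k
      rw [div_mul_div_comm, Real.mul_self_sqrt (hpos k).le]
    simp only [h1]
    rw [Finset.prod_div_distrib, Finset.prod_mul_distrib,
      eq_div_iff (Finset.prod_pos fun k _ => hpos k).ne', hw, hfull i, hfull j]
    linear_combination ((∏ k, u k (i k)) * ∏ k, u k (j k)) * hone
end

section
/- Let F ∈ ℝ^{n₁×⋯×n_m} (m ≥ 2) with multilinear form F(x¹,…,x^m), set m' = m−1, F_j(x¹,…,x^{m'}) = F(x¹,…,x^{m'}, e_j) for j = 1,…,n_m, F^{sq} = Σ_j F_j², and h = ‖x¹‖²⋯‖x^{m'}‖². Let F_max = max of F^{sq}(x¹,…,x^{m'}) over unit vectors x^k ∈ ℝ^{n_k}. Let w* ∈ ℝ^Ω be symmetric and a maximizer of ⟨F^{sq}, w⟩ over {w symmetric : K(w) ⪰ 0, ⟨h, w⟩ = 1}, and suppose ⟨F^{sq}, w*⟩ = F_max (the relaxation is tight). Suppose moreover that σ := F_max·h − F^{sq} is a smooth point of the boundary of Σ_{n₁,…,n_{m'}} in the following sense: there exists a nonzero linear functional ℓ on V with ℓ ≥ 0 on Σ_{n₁,…,n_{m'}} and ℓ(σ)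 = 0, and any two such functionals are positive scalar multiples of each other. Then rank K(w*) = 1. -/
open Finset

/-- The multilinear form associated to a tensor `F ∈ ℝ^{n₁ × ⋯ × n_m}`. -/
def mform {m : ℕ} {n : Fin m → ℕ} (F : (∀ j, Fin (n j)) → ℝ)
    (x : ∀ j, Fin (n j) → ℝ) : ℝ :=
  ∑ i : (∀ j, Fin (n j)), F i * ∏ j, x j (i j)

/-- The canonical symmetric coefficients of `F^{sq} = ∑_j F_j²` as an element of `V`:
`G_{ı,ȷ} = ∑_j F_{ı₁,…,ı_{m'},j} F_{ȷ₁,…,ȷ_{m'},j}`. -/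
def Gcoef {m' : ℕ} {n : Fin (m' + 1) → ℕ} (F : (∀ j, Fin (n j)) → ℝ)
    (i j : ∀ k : Fin m', Fin (n k.castSucc)) : ℝ :=
  ∑ s : Fin (n (Fin.last m')), F (Fin.snoc i s) * F (Fin.snoc j s)

/-- `w ∈ ℝ^Ω` is symmetric: `w_{ı,ȷ} = w_{ȷ,ı}` and `w` is invariant under swapping
`ı_k` with `ȷ_k` in any single coordinate `k`. -/
def SymW {m' : ℕ} {n : Fin (m' + 1) → ℕ}
    (w : (∀ k : Fin m', Fin (n k.castSucc)) → (∀ k : Fin m', Fin (n k.castSucc)) → ℝ) :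
    Prop :=
  (∀ i j, w i j = w j i) ∧
  ∀ i j (k : Fin m'), w i j = w (Function.update i k (j k)) (Function.update j k (i k))

lemma mform_snoc_single {m' : ℕ} {n : Fin (m' + 1) → ℕ} (F : (∀ j, Fin (n j)) → ℝ)
    (x : ∀ k : Fin m', Fin (n k.castSucc) → ℝ) (s : Fin (n (Fin.last m'))) :
    mform F (Fin.snoc x (Pi.single s 1)) =
      ∑ i : (∀ k : Fin m', Fin (n k.castSucc)), F (Fin.snoc i s) * ∏ k, x k (i k) := by
  unfold mform
  rw [← (Fin.snocEquiv (fun j => Fin (n j))).sum_comp, Fintype.sum_prod_type,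
    Finset.sum_eq_single s]
  · simp [Fin.snocEquiv, Fin.prod_univ_castSucc]
  · intro t _ ht
    simp [Fin.snocEquiv, Fin.prod_univ_castSucc, ht]
  · simp

lemma sum_Gcoef_mul {m' : ℕ} {n : Fin (m' + 1) → ℕ} (F : (∀ j, Fin (n j)) → ℝ)
    (v : (∀ k : Fin m', Fin (n k.castSucc)) → ℝ) :
    ∑ i, ∑ j, Gcoef F i j * (v i * v j) = ∑ s, (∑ i, F (Fin.snoc i s) * v i) ^ 2 := by
  simp_rw [sq, Finset.sum_mul_sum, Gcoef, Finset.sum_mul]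
  rw [Finset.sum_comm]
  simp_rw [Finset.sum_comm (s := (Finset.univ : Finset (Fin (n (Fin.last m')))))]
  rw [Finset.sum_comm]
  refine Finset.sum_congr rfl fun i _ => Finset.sum_congr rfl fun j _ =>
    Finset.sum_congr rfl fun s _ => by ring

lemma symW_prod {m' : ℕ} {n : Fin (m' + 1) → ℕ} (x : ∀ k : Fin m', Fin (n k.castSucc) → ℝ) :
    SymW (n := n) (fun i j => (∏ k, x k (i k)) * ∏ k, x k (j k)) := by
  refine ⟨fun i j => mul_comm _ _, fun i j k => ?_⟩
  simp only [← Finset.prod_mul_distrib]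
  refine Finset.prod_congr rfl fun l _ => ?_
  by_cases h : l = k
  · subst h; simp [mul_comm]
  · simp [h]

lemma sum_prod_sq {m' : ℕ} {n : Fin (m' + 1) → ℕ} (x : ∀ k : Fin m', Fin (n k.castSucc) → ℝ)
    (hx : ∀ k, ∑ s, (x k s) ^ 2 = 1) :
    ∑ i : (∀ k : Fin m', Fin (n k.castSucc)), (∏ k, x k (i k)) * ∏ k, x k (i k) = 1 := by
  simp_rw [← Finset.prod_mul_distrib, ← sq]
  rw [← Fintype.piFinset_univ, ← Finset.prod_univ_sum (fun _ => univ) (fun k s => x k s ^ 2)]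
  simp [hx]

lemma pair_sigma {I : Type*} [Fintype I] [DecidableEq I] (G z : I → I → ℝ) (a : ℝ)
    (h1 : ∑ i, z i i = 1) (h2 : ∑ i, ∑ j, G i j * z i j = a) :
    ∑ i, ∑ j, (a * (if i = j then 1 else 0) - G i j) * z i j = 0 := by
  simp_rw [sub_mul, Finset.sum_sub_distrib]
  rw [h2]
  simp [← Finset.mul_sum, h1]

lemma rank_one_aux {I : Type*} [Fintype I] [DecidableEq I] (w : I → I → ℝ) (v : I → ℝ) (a : ℝ)
    (hw : w = fun i j => a * (v i * v j)) (h0 : ∑ i, w i i = 1) : (Matrix.of w).rank = 1 := by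
  have h : Matrix.of w = Matrix.vecMulVec (fun i => a * v i) v := by
    ext i j
    simp [hw, Matrix.vecMulVec_apply, mul_assoc]
  apply le_antisymm
  · rw [h]; exact Matrix.rank_vecMulVec_le _ _
  · rw [Nat.one_le_iff_ne_zero]
    intro hr
    rw [Matrix.rank, Submodule.finrank_eq_zero, LinearMap.range_eq_bot] at hr
    have : w = 0 := by
      funext i j
      have := congrFun (LinearMap.congr_fun hr (Pi.single j 1)) i
      simpa using this
    simp [this] at h0

/-- If the semidefinite relaxation for the nonsymmetric best rank-1 problem is tight at
an optimizer `w*` and `σ = F_max·h − F^{sq}` is a smooth boundary point of the cone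
`Σ_{n₁,…,n_{m'}}` of sums of squares of multilinear forms (there is a supporting linear
functional at `σ`, unique up to positive scaling; functionals on `V` being represented
by symmetric vectors `z ∈ ℝ^Ω`), then `rank K(w*) = 1`.
Here the order of the tensor is `m = m' + 1 ≥ 2`, `F_j(x¹,…,x^{m'}) = F(x¹,…,x^{m'},e_j)`,
`F^{sq} = ∑_j F_j²` (with coefficients `Gcoef`), `h = ‖x¹‖²⋯‖x^{m'}‖²` (with coefficients
`δ_{ı,ȷ}`, so `⟨h, w⟩ = ∑_ı w_{ı,ı}`), and `K(w)_{ı,ȷ} = w_{ı,ȷ}`. -/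
theorem stmt_19 (m' : ℕ) (hm' : 1 ≤ m') (n : Fin (m' + 1) → ℕ) (hn : ∀ j, 0 < n j)
    (F : (∀ j, Fin (n j)) → ℝ) (Fmax : ℝ)
    (hFmax : IsGreatest {r : ℝ | ∃ x' : ∀ k : Fin m', Fin (n k.castSucc) → ℝ,
      (∀ k, ∑ s, (x' k s) ^ 2 = 1) ∧
      (∑ s, (mform F (Fin.snoc x' (Pi.single s 1))) ^ 2) = r} Fmax)
    (w : (∀ k : Fin m', Fin (n k.castSucc)) → (∀ k : Fin m', Fin (n k.castSucc)) → ℝ)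
    (hsym : SymW w) (hpsd : (Matrix.of w).PosSemidef)
    (hfeas : ∑ i, w i i = 1)
    (hopt : ∀ w', SymW w' → (Matrix.of w').PosSemidef → (∑ i, w' i i = 1) →
      (∑ i, ∑ j, Gcoef F i j * w' i j) ≤ ∑ i, ∑ j, Gcoef F i j * w i j)
    (htight : (∑ i, ∑ j, Gcoef F i j * w i j) = Fmax)
    (hsmooth : ∃ z, z ≠ 0 ∧ SymW z ∧
      (∀ c : (∀ k : Fin m', Fin (n k.castSucc)) → ℝ,
        0 ≤ ∑ i, ∑ j, c i * c j * z i j) ∧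
      (∑ i, ∑ j, (Fmax * (if i = j then 1 else 0) - Gcoef F i j) * z i j = 0) ∧
      (∀ z', z' ≠ 0 → SymW z' →
        (∀ c : (∀ k : Fin m', Fin (n k.castSucc)) → ℝ,
          0 ≤ ∑ i, ∑ j, c i * c j * z' i j) →
        (∑ i, ∑ j, (Fmax * (if i = j then 1 else 0) - Gcoef F i j) * z' i j = 0) →
        ∃ t : ℝ, 0 < t ∧ z' = fun i j => t * z i j)) :
    (Matrix.of w).rank = 1 := by
  obtain ⟨⟨x, hx, hxF⟩, -⟩ := hFmax
  obtain ⟨z, -, -, -, -, huniq⟩ := hsmooth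
  have hv1 := sum_prod_sq x hx
  obtain ⟨t, ht, hwt⟩ := huniq w (by rintro rfl; simp at hfeas) hsym
    (fun c => by
      have := hpsd.dotProduct_mulVec_nonneg c
      simp only [dotProduct, Matrix.mulVec, Matrix.of_apply, Finset.mul_sum] at this
      refine this.trans_eq ?_
      refine Finset.sum_congr rfl fun i _ => Finset.sum_congr rfl fun j _ => ?_
      simp only [Pi.star_apply, star_trivial]
      ring)
    (pair_sigma _ _ _ hfeas htight)
  obtain ⟨s, hs, hvs⟩ := huniq (fun i j => (∏ k, x k (i k)) * ∏ k, x k (j k))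
    (fun h => by
      have h' := fun i => congrFun (congrFun h i) i
      simp only [Pi.zero_apply] at h'
      simp only [h'] at hv1
      simp at hv1) (symW_prod x)
    (fun c => by
      have : ∑ i, ∑ j, c i * c j * ((∏ k, x k (i k)) * ∏ k, x k (j k))
          = (∑ i, c i * ∏ k, x k (i k)) ^ 2 := by
        rw [sq, Finset.sum_mul_sum]
        refine Finset.sum_congr rfl fun i _ => Finset.sum_congr rfl fun j _ => by ring
      rw [this]
      positivity)
    (pair_sigma _ _ _ hv1 (by
      rw [sum_Gcoef_mul F (fun i => ∏ k, x k (i k)), ← hxF]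
      simp_rw [mform_snoc_single]))
  refine rank_one_aux w (fun i => ∏ k, x k (i k)) (t / s) ?_ hfeas
  rw [hwt]
  funext i j
  have := congrFun (congrFun hvs i) j
  rw [this]
  field_simp
end
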